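/- arXiv:1112.1511 — 3 statements merged into one kernel-verified Lean document; each statement's English description precedes it below -/
import Mathlib

section
/- Let P be a polynomial on ℝⁿ (n ≥ 2), μ a finite signed measure with support in the closed ball of radius R, and Q_P the corresponding function of the second kind. Then the function x = rθ ↦ r^{−(n−1)} Q_P(r,θ), defined for r > R and θ ∈ S^{n-1}, is polyharmonic of polyharmonic degree < N_P on {x ∈ ℝⁿ : |x| > R}, i.e. Δ^{N_P} applied to this function vanishes there, where N_P := sup{d(P·h) : h a harmonic polynomial on ℝⁿ}. -/
open MeasureTheory Metric MvPolynomial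

noncomputable section

/-- `ℝⁿ` as a Euclidean space. -/
abbrev En (n : ℕ) : Type := EuclideanSpace ℝ (Fin n)

/-- The Laplace operator `Δ = ∂²/∂x₁² + … + ∂²/∂xₙ²` acting on polynomials. -/
def lap (n : ℕ) (P : MvPolynomial (Fin n) ℂ) : MvPolynomial (Fin n) ℂ :=
  ∑ i : Fin n, pderiv i (pderiv i P)

/-- A polynomial is harmonic if `ΔP = 0`. -/
def IsHarmonicPoly (n : ℕ) (P : MvPolynomial (Fin n) ℂ) : Prop := lap n P = 0

/-- The polyharmonic degree `d(P) = min {N : Δ^(N+1) P = 0}`. -/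
def pdeg (n : ℕ) (P : MvPolynomial (Fin n) ℂ) : ℕ := sInf {N : ℕ | (lap n)^[N + 1] P = 0}

/-- Evaluation of a polynomial at a real point of `ℝⁿ`. -/
def evalR {n : ℕ} (P : MvPolynomial (Fin n) ℂ) (x : En n) : ℂ :=
  eval (fun i => (x i : ℂ)) P

/-- Evaluation of a polynomial at `ζθ`, i.e. after substituting `ζ θ i` for `x i`. -/
def evalC {n : ℕ} (P : MvPolynomial (Fin n) ℂ) (ζ : ℂ) (θ : En n) : ℂ :=
  eval (fun i => ζ * (θ i : ℂ)) P

/-- The surface measure on the unit sphere `S^{n-1} ⊂ ℝⁿ`. -/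
def sphereMeasure (n : ℕ) : Measure (sphere (0 : En n) 1) :=
  (volume : Measure (En n)).toSphere

/-- `ω_n`, the surface area of the unit sphere `S^{n-1}`. -/
def omegaN (n : ℕ) : ℝ := ((sphereMeasure n) Set.univ).toReal

/-- The analytic continuation of `ζ ↦ r(ζθ − x)ⁿ = |ζθ − x|ⁿ` to `|ζ| > |x|`
(principal branch; for real `ζ = ρ > |x|` it equals `|ρθ − x|ⁿ`, for `θ` on the
unit sphere). -/
def rPow (n : ℕ) (ζ : ℂ) (θ x : En n) : ℂ :=
  ζ ^ n * (1 - 2 * ((inner ℝ θ x : ℝ) : ℂ) / ζ + ((‖x‖ : ℂ)) ^ 2 / ζ ^ 2) ^ ((n : ℂ) / 2)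

/-- Integral of a complex-valued function against a finite signed measure
(via the Jordan decomposition). -/
def sInt {α : Type*} [MeasurableSpace α] (μ : SignedMeasure α) (f : α → ℂ) : ℂ :=
  ∫ x, f x ∂μ.toJordanDecomposition.posPart - ∫ x, f x ∂μ.toJordanDecomposition.negPart

/-- The support of the signed measure `μ` is contained in the set `s`. -/
def SuppIn {α : Type*} [MeasurableSpace α] (μ : SignedMeasure α) (s : Set α) : Prop :=
  μ.totalVariation sᶜ = 0

/-- The multivariate Markov transform of a finite signed measure. -/
def markov {n : ℕ} (μ : SignedMeasure (En n)) (ζ : ℂ) (θ : En n) : ℂ :=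
  (omegaN n : ℂ)⁻¹ * sInt μ fun x => ζ ^ (n - 1) / rPow n ζ θ x

/-- The multivariate Markov transform of a (nonnegative) measure. -/
def markovM {n : ℕ} (μ : Measure (En n)) (ζ : ℂ) (θ : En n) : ℂ :=
  (omegaN n : ℂ)⁻¹ * ∫ x, ζ ^ (n - 1) / rPow n ζ θ x ∂μ

/-- The function of the second kind `Q_P` for a signed measure. -/
def qP {n : ℕ} (μ : SignedMeasure (En n)) (P : MvPolynomial (Fin n) ℂ) (ζ : ℂ) (θ : En n) : ℂ :=
  (omegaN n : ℂ)⁻¹ * sInt μ fun x => (evalC P ζ θ - evalR P x) * ζ ^ (n - 1) / rPow n ζ θ x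

/-- The function of the second kind `Q_P` for a (nonnegative) measure. -/
def qPM {n : ℕ} (μ : Measure (En n)) (P : MvPolynomial (Fin n) ℂ) (ζ : ℂ) (θ : En n) : ℂ :=
  (omegaN n : ℂ)⁻¹ * ∫ x, (evalC P ζ θ - evalR P x) * ζ ^ (n - 1) / rPow n ζ θ x ∂μ

/-- The rest function `R_P` for a signed measure. -/
def restP {n : ℕ} (μ : SignedMeasure (En n)) (P : MvPolynomial (Fin n) ℂ) (ζ : ℂ) (θ : En n) : ℂ :=
  (omegaN n : ℂ)⁻¹ * sInt μ fun x => evalR P x * ζ ^ (n - 1) / rPow n ζ θ x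
/-- The Laplace operator `Δ` acting on functions `ℝⁿ → ℂ`. -/
def fnLap (n : ℕ) (f : En n → ℂ) : En n → ℂ := fun x =>
  ∑ i : Fin n,
    fderiv ℝ (fun y => fderiv ℝ f y (EuclideanSpace.single i (1 : ℝ))) x
      (EuclideanSpace.single i (1 : ℝ))

section

/-! ### Algebra -/

/-- Laplacian as linear map. -/
def LL (n : ℕ) : MvPolynomial (Fin n) ℂ →ₗ[ℂ] MvPolynomial (Fin n) ℂ :=
  ∑ i : Fin n, (pderiv i).toLinearMap ∘ₗ (pderiv i).toLinearMap

/-- Euler operator. -/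
def EU (n : ℕ) : MvPolynomial (Fin n) ℂ →ₗ[ℂ] MvPolynomial (Fin n) ℂ :=
  ∑ i : Fin n, LinearMap.mulLeft ℂ (X i) ∘ₗ (pderiv i).toLinearMap

/-- squared norm polynomial. -/
def r2 (n : ℕ) : MvPolynomial (Fin n) ℂ := ∑ i : Fin n, X i ^ 2

lemma LL_apply (n : ℕ) (P : MvPolynomial (Fin n) ℂ) :
    LL n P = ∑ i : Fin n, pderiv i (pderiv i P) := by
  simp [LL]

lemma lap_eq (n : ℕ) : lap n = ⇑(LL n) := by
  funext P; rw [LL_apply]; rfl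

lemma lap_iter (n a : ℕ) (P : MvPolynomial (Fin n) ℂ) : (lap n)^[a] P = (LL n ^ a) P := by
  rw [lap_eq, Module.End.pow_apply]

lemma EU_apply (n : ℕ) (P : MvPolynomial (Fin n) ℂ) :
    EU n P = ∑ i : Fin n, X i * pderiv i P := by
  simp [EU]

lemma pderiv_comm' {n : ℕ} (i j : Fin n) (P : MvPolynomial (Fin n) ℂ) :
    pderiv i (pderiv j P) = pderiv j (pderiv i P) := by
  have h : ⁅(pderiv i : Derivation ℂ (MvPolynomial (Fin n) ℂ) (MvPolynomial (Fin n) ℂ)),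
      (pderiv j : Derivation ℂ (MvPolynomial (Fin n) ℂ) (MvPolynomial (Fin n) ℂ))⁆ = 0 := by
    apply MvPolynomial.derivation_ext
    intro k
    rw [Derivation.commutator_apply]
    simp [pderiv_X, Pi.single_apply]
    split_ifs <;> simp
  have := congrArg (fun d => d P) h
  simp only [Derivation.commutator_apply, Derivation.zero_apply] at this
  exact sub_eq_zero.mp this

lemma LL_mul {n : ℕ} (F G : MvPolynomial (Fin n) ℂ) :
    LL n (F * G) = LL n F * G + F * LL n G + 2 * ∑ i, pderiv i F * pderiv i G := by
  simp only [LL_apply, Finset.sum_mul, Finset.mul_sum, ← Finset.sum_add_distrib]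
  refine Finset.sum_congr rfl fun i _ => ?_
  simp only [pderiv_mul, map_add]
  ring

lemma pderiv_r2 {n : ℕ} (i : Fin n) : pderiv i (r2 n) = 2 * X i := by
  classical
  simp only [r2, map_sum, pderiv_pow, pderiv_X, Pi.single_apply]
  rw [Finset.sum_eq_single i] <;> simp +contextual

lemma LL_r2_mul {n : ℕ} (F : MvPolynomial (Fin n) ℂ) :
    LL n (r2 n * F) = r2 n * LL n F + (2 * n : ℂ) • F + (4 : ℂ) • EU n F := by
  rw [LL_mul]
  have h1 : LL n (r2 n) = C (2 * n : ℂ) := by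
    rw [LL_apply]
    have : ∀ i : Fin n, pderiv i (pderiv i (r2 n)) = 2 := by
      intro i
      rw [pderiv_r2, pderiv_mul]
      have : (2 : MvPolynomial (Fin n) ℂ) = C 2 := (map_ofNat C 2).symm
      rw [this, pderiv_C]; simp
    have h2 : (2 : MvPolynomial (Fin n) ℂ) = C 2 := (map_ofNat C 2).symm
    simp [this, mul_comm, ← h2]
  rw [h1, EU_apply, smul_eq_C_mul, smul_eq_C_mul]
  simp only [pderiv_r2, mul_assoc, ← Finset.mul_sum]
  have : (C 4 : MvPolynomial (Fin n) ℂ) = 4 := map_ofNat C 4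
  rw [this]
  ring

lemma EU_mul {n : ℕ} (F G : MvPolynomial (Fin n) ℂ) :
    EU n (F * G) = EU n F * G + F * EU n G := by
  simp only [EU_apply, Finset.sum_mul, Finset.mul_sum, ← Finset.sum_add_distrib]
  refine Finset.sum_congr rfl fun i _ => ?_
  simp only [pderiv_mul]
  ring

lemma EU_r2 {n : ℕ} : EU n (r2 n) = 2 * r2 n := by
  simp only [EU_apply, pderiv_r2]
  rw [r2, Finset.mul_sum]
  refine Finset.sum_congr rfl fun i _ => by ring

lemma pderiv_EU {n : ℕ} (i : Fin n) (F : MvPolynomial (Fin n) ℂ) :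
    pderiv i (EU n F) = pderiv i F + EU n (pderiv i F) := by
  classical
  simp only [EU_apply, map_sum, pderiv_mul, Finset.sum_add_distrib]
  have e1 : ∑ j, pderiv i (X j : MvPolynomial (Fin n) ℂ) * pderiv j F = pderiv i F := by
    rw [Finset.sum_eq_single i]
    · rw [pderiv_X_self, one_mul]
    · intro b _ hb
      rw [pderiv_X_of_ne hb, zero_mul]
    · simp
  rw [e1]
  exact congrArg (pderiv i F + ·) (Finset.sum_congr rfl fun j _ => by rw [pderiv_comm'])

lemma LL_EU {n : ℕ} (F : MvPolynomial (Fin n) ℂ) :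
    LL n (EU n F) = EU n (LL n F) + (2 : ℂ) • LL n F := by
  simp only [LL_apply, pderiv_EU, map_add, map_sum, Finset.sum_add_distrib, Finset.smul_sum]
  simp only [two_smul, Finset.sum_add_distrib]
  abel

lemma LL_pow_r2_mul {n : ℕ} (a : ℕ) (F : MvPolynomial (Fin n) ℂ) :
    (LL n ^ (a + 1)) (r2 n * F) = r2 n * (LL n ^ (a + 1)) F +
      ((a + 1 : ℂ) * (2 * n + 4 * a)) • (LL n ^ a) F +
      ((a + 1 : ℂ) * 4) • EU n ((LL n ^ a) F) := by
  induction a with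
  | zero => simp [LL_r2_mul]
  | succ a ih =>
    rw [pow_succ', Module.End.mul_apply, ih]
    simp only [map_add, map_smul, LL_r2_mul, LL_EU]
    have e : ∀ b, LL n ((LL n ^ b) F) = (LL n ^ (b + 1)) F := by
      intro b; rw [pow_succ', Module.End.mul_apply]
    simp only [e, ← Module.End.mul_apply, ← pow_succ']
    push_cast
    module

lemma LL_pow_r2_mul_zero {n : ℕ} {a : ℕ} {F : MvPolynomial (Fin n) ℂ} (h : (LL n ^ a) F = 0) :
    (LL n ^ (a + 1)) (r2 n * F) = 0 := by
  rw [LL_pow_r2_mul, h, pow_succ', Module.End.mul_apply, h]; simp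

lemma LL_pow_r2_pow_mul_zero {n : ℕ} {a : ℕ} {F : MvPolynomial (Fin n) ℂ} (h : (LL n ^ a) F = 0)
    (j : ℕ) : (LL n ^ (a + j)) (r2 n ^ j * F) = 0 := by
  induction j with
  | zero => simpa
  | succ j ih => rw [pow_succ', mul_assoc, ← add_assoc]; exact LL_pow_r2_mul_zero ih

lemma LL_pow_zero_mono {n : ℕ} {a b : ℕ} {F : MvPolynomial (Fin n) ℂ} (h : (LL n ^ a) F = 0)
    (hab : a ≤ b) : (LL n ^ b) F = 0 := by
  obtain ⟨c, rfl⟩ := Nat.exists_eq_add_of_le hab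
  rw [add_comm, pow_add, Module.End.mul_apply, h, map_zero]

lemma homog_zero_C {n : ℕ} {F : MvPolynomial (Fin n) ℂ} (h : F.IsHomogeneous 0) :
    ∃ c, F = C c := by
  rw [← totalDegree_zero_iff_isHomogeneous, totalDegree_eq_zero_iff_eq_C] at h
  exact ⟨_, h⟩

lemma LL_homog {n k : ℕ} {F : MvPolynomial (Fin n) ℂ} (h : F.IsHomogeneous k) :
    (LL n F).IsHomogeneous (k - 2) := by
  rw [LL_apply]
  exact IsHomogeneous.sum _ _ _ fun i _ => h.pderiv.pderiv

lemma LL_homog_zero {n k : ℕ} {F : MvPolynomial (Fin n) ℂ} (h : F.IsHomogeneous k) (hk : k < 2) :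
    LL n F = 0 := by
  rw [LL_apply]
  refine Finset.sum_eq_zero fun i _ => ?_
  have h1 : (pderiv i F).IsHomogeneous 0 := by
    have := h.pderiv (i := i)
    rwa [show k - 1 = 0 by omega] at this
  obtain ⟨c, hc⟩ := homog_zero_C h1
  rw [hc, pderiv_C]

lemma LL_pow_homog {n k : ℕ} {F : MvPolynomial (Fin n) ℂ} (h : F.IsHomogeneous k) (a : ℕ) :
    ((LL n ^ a) F).IsHomogeneous (k - 2 * a) ∧ (k < 2 * a → (LL n ^ a) F = 0) := by
  induction a with
  | zero => simpa
  | succ a ih =>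
    rw [pow_succ', Module.End.mul_apply]
    refine ⟨?_, fun hk => ?_⟩
    · have := LL_homog ih.1
      rwa [show k - 2 * (a + 1) = k - 2 * a - 2 by omega]
    · exact LL_homog_zero ih.1 (by omega)

lemma EU_homog {n k : ℕ} {F : MvPolynomial (Fin n) ℂ} (h : F.IsHomogeneous k) :
    EU n F = (k : ℂ) • F := by
  rw [EU_apply, h.sum_X_mul_pderiv, Nat.cast_smul_eq_nsmul]

/-- Leibniz bound. -/
lemma LL_pow_mul_harm {n : ℕ} (p : ℕ) : ∀ (F h : MvPolynomial (Fin n) ℂ), F.IsHomogeneous p →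
    LL n h = 0 → (LL n ^ (p + 1)) (F * h) = 0 := by
  induction p using Nat.strong_induction_on with
  | _ p ih =>
    intro F h hF hh
    rcases Nat.eq_zero_or_pos p with rfl | hp
    · obtain ⟨c, rfl⟩ := homog_zero_C hF
      simp [← smul_eq_C_mul, hh]
    · rw [pow_succ, Module.End.mul_apply, LL_mul, hh, mul_zero, add_zero, map_add]
      have e1 : (LL n ^ p) (LL n F * h) = 0 := by
        by_cases h2 : p < 2
        · rw [LL_homog_zero hF h2]; simp
        · exact LL_pow_zero_mono (ih (p - 2) (by omega) _ _ (LL_homog hF) hh) (by omega)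
      have e2 : (LL n ^ p) (2 * ∑ i, pderiv i F * pderiv i h) = 0 := by
        have : (2 : MvPolynomial (Fin n) ℂ) = C 2 := (map_ofNat C 2).symm
        rw [this, ← smul_eq_C_mul, map_smul, map_sum]
        rw [Finset.sum_eq_zero, smul_zero]
        intro i _
        have := ih (p - 1) (by omega) (pderiv i F) (pderiv i h) hF.pderiv (by
          have := congrArg (pderiv i) hh
          rw [LL_apply, map_sum, map_zero] at this
          rw [LL_apply, ← this]
          refine Finset.sum_congr rfl fun j _ => ?_
          rw [pderiv_comm' i j, pderiv_comm' i j])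
        rwa [show p - 1 + 1 = p by omega] at this
      rw [e1, e2, add_zero]

lemma LL_pderiv {n : ℕ} (i : Fin n) (h : MvPolynomial (Fin n) ℂ) :
    LL n (pderiv i h) = pderiv i (LL n h) := by
  simp only [LL_apply, map_sum]
  refine Finset.sum_congr rfl fun j _ => ?_
  rw [pderiv_comm' i j, pderiv_comm' i j]

/-- conjugate polynomial -/
def cj {n : ℕ} (h : MvPolynomial (Fin n) ℂ) : MvPolynomial (Fin n) ℂ := map (starRingEnd ℂ) h

lemma LL_cj {n : ℕ} (h : MvPolynomial (Fin n) ℂ) : LL n (cj h) = cj (LL n h) := by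
  simp only [LL_apply, cj, map_sum, pderiv_map]

lemma pderiv_ne_zero {n p : ℕ} {H : MvPolynomial (Fin n) ℂ} (h : H.IsHomogeneous (p + 1))
    (h0 : H ≠ 0) : ∃ i, pderiv i H ≠ 0 := by
  by_contra! hc
  have := EU_homog h
  rw [EU_apply] at this
  simp only [hc, mul_zero, Finset.sum_const_zero] at this
  have := (smul_eq_zero.mp this.symm).resolve_right h0
  norm_cast at this

lemma LL_pow_HcjH {n : ℕ} (p : ℕ) : ∀ H : MvPolynomial (Fin n) ℂ, H.IsHomogeneous p →
    LL n H = 0 → ∃ r : ℝ, 0 ≤ r ∧ (LL n ^ p) (H * cj H) = C (r : ℂ) ∧ (H ≠ 0 → 0 < r) := by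
  induction p with
  | zero =>
    intro H hH _
    obtain ⟨c, rfl⟩ := homog_zero_C hH
    refine ⟨Complex.normSq c, Complex.normSq_nonneg _, ?_, fun h => ?_⟩
    · simp only [cj, map_C, pow_zero, Module.End.one_apply, ← C_mul]
      rw [Complex.mul_conj]
    · apply Complex.normSq_pos.mpr
      rintro rfl; simp at h
  | succ p ih =>
    intro H hH hh
    have h1 : ∀ i, LL n (pderiv i H) = 0 := fun i => by rw [LL_pderiv, hh, map_zero]
    choose r hr0 hr hrp using fun i => ih (pderiv i H) hH.pderiv (h1 i)
    refine ⟨2 * ∑ i, r i, mul_nonneg (by norm_num) (Finset.sum_nonneg fun i _ => hr0 i), ?_, ?_⟩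
    · rw [pow_succ, Module.End.mul_apply, LL_mul, LL_cj, hh]
      have : (2 : MvPolynomial (Fin n) ℂ) = C 2 := (map_ofNat C 2).symm
      have e : ∀ i, pderiv i (cj H) = cj (pderiv i H) := fun i => by simp [cj, pderiv_map]
      simp only [zero_mul, zero_add, cj, map_zero, mul_zero]
      rw [this, ← smul_eq_C_mul, map_smul, map_sum]
      simp only [cj] at e hr
      simp only [e, hr]
      rw [smul_eq_C_mul]
      push_cast
      simp
    · intro hne
      obtain ⟨i, hi⟩ := pderiv_ne_zero hH hne
      refine mul_pos (by norm_num) (Finset.sum_pos' (fun i _ => hr0 i) ⟨i, Finset.mem_univ _, hrp i hi⟩)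

lemma EU_r2_pow_mul {n : ℕ} (b : ℕ) {H : MvPolynomial (Fin n) ℂ} {c : ℂ} (h : EU n H = c • H) :
    EU n (r2 n ^ b * H) = (2 * b + c) • (r2 n ^ b * H) := by
  induction b with
  | zero => simp [h]
  | succ b ih =>
    rw [pow_succ', mul_assoc, EU_mul, ih, EU_r2]
    have : (2 : MvPolynomial (Fin n) ℂ) = C 2 := (map_ofNat C 2).symm
    rw [this, mul_assoc, ← smul_eq_C_mul, mul_smul_comm]
    push_cast
    module

lemma LL_r2_pow_mul {n : ℕ} (b : ℕ) {H : MvPolynomial (Fin n) ℂ} {c : ℂ} (h : EU n H = c • H)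
    (hh : LL n H = 0) : LL n (r2 n ^ (b + 1) * H) =
      (2 * (b + 1) * (2 * b + n + 2 * c) : ℂ) • (r2 n ^ b * H) := by
  induction b with
  | zero => 
    simp only [pow_zero, zero_add, pow_one, one_mul]
    rw [LL_r2_mul, hh, h]; simp; module
  | succ b ih =>
    rw [pow_succ', mul_assoc, LL_r2_mul, ih, EU_r2_pow_mul _ h, mul_smul_comm, ← mul_assoc,
      ← pow_succ']
    push_cast
    module

lemma LL_pow_r2_pow_harm {n : ℕ} (hn : 2 ≤ n) {m : ℕ} {H : MvPolynomial (Fin n) ℂ}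
    (h : H.IsHomogeneous m) (hh : LL n H = 0) (a : ℕ) :
    ∃ c : ℂ, c ≠ 0 ∧ (LL n ^ a) (r2 n ^ a * H) = c • H := by
  induction a with
  | zero => exact ⟨1, one_ne_zero, by simp⟩
  | succ a ih =>
    obtain ⟨c, hc, e⟩ := ih
    refine ⟨(2 * (a + 1) * (2 * a + n + 2 * m) : ℂ) * c, mul_ne_zero ?_ hc, ?_⟩
    · have : 2 * (a + 1) * (2 * a + n + 2 * m) ≠ 0 := by positivity
      exact_mod_cast this
    · rw [pow_succ, Module.End.mul_apply, LL_r2_pow_mul _ (EU_homog h) hh, map_smul, e, smul_smul]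

lemma r2_homog (n : ℕ) : (r2 n).IsHomogeneous 2 :=
  IsHomogeneous.sum _ _ _ fun i _ => by simpa using (isHomogeneous_X_pow (R := ℂ) i 2)

/-- Almansi/Gauss decomposition. -/
lemma almansi {n : ℕ} (hn : 2 ≤ n) (k a : ℕ) : ∀ Q : MvPolynomial (Fin n) ℂ, Q.IsHomogeneous k →
    (LL n ^ a) Q = 0 → ∃ H : ℕ → MvPolynomial (Fin n) ℂ,
      (∀ i, (H i).IsHomogeneous (k - 2 * i)) ∧ (∀ i, LL n (H i) = 0) ∧
      (∀ i, k < 2 * i → H i = 0) ∧ Q = ∑ i ∈ Finset.range a, r2 n ^ i * H i := by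
  induction a with
  | zero =>
    intro Q hQ h
    exact ⟨0, fun i => isHomogeneous_zero _ _ _, by simp, by simp, by simpa using h⟩
  | succ a ih =>
    intro Q hQ h
    obtain ⟨g1, g2⟩ := LL_pow_homog hQ a
    set G := (LL n ^ a) Q with hG
    have hGh : LL n G = 0 := by rw [hG, ← Module.End.mul_apply, ← pow_succ', h]
    obtain ⟨c, hc, e⟩ := LL_pow_r2_pow_harm hn g1 hGh a
    have hK : (r2 n ^ a * (c⁻¹ • G)).IsHomogeneous k := by
      by_cases hk : k < 2 * a
      · rw [g2 hk]; simpa using isHomogeneous_zero _ _ _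
      · have := ((r2_homog n).pow a).mul (g1.C_mul c⁻¹)
        rw [smul_eq_C_mul]
        rwa [show 2 * a + (k - 2 * a) = k by omega] at this
    obtain ⟨H, h1, h2, h3, h4⟩ := ih (Q - r2 n ^ a * (c⁻¹ • G)) (hQ.sub hK) (by
      rw [map_sub, mul_smul_comm, map_smul, e, smul_smul, inv_mul_cancel₀ hc, one_smul, sub_self])
    refine ⟨Function.update H a (c⁻¹ • G), ?_, ?_, ?_, ?_⟩
    · intro i
      by_cases hi : i = a
      · subst hi; rw [Function.update_self, smul_eq_C_mul]; exact g1.C_mul _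
      · rw [Function.update_of_ne hi]; exact h1 i
    · intro i
      by_cases hi : i = a
      · subst hi; rw [Function.update_self, map_smul, hGh, smul_zero]
      · rw [Function.update_of_ne hi]; exact h2 i
    · intro i hk
      by_cases hi : i = a
      · subst hi; rw [Function.update_self, g2 hk, smul_zero]
      · rw [Function.update_of_ne hi]; exact h3 i hk
    · rw [Finset.sum_range_succ, Function.update_self]
      have : ∑ i ∈ Finset.range a, r2 n ^ i * Function.update H a (c⁻¹ • G) i =
          ∑ i ∈ Finset.range a, r2 n ^ i * H i := by
        refine Finset.sum_congr rfl fun i hi => ?_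
        rw [Function.update_of_ne (by simp at hi; omega)]
      rw [this, ← h4]; ring

end

section

lemma LL_pow_r2_pow_mul_top {n : ℕ} (hn : 2 ≤ n) {m : ℕ} {F : MvPolynomial (Fin n) ℂ}
    (hF : F.IsHomogeneous (2 * m)) (h0 : (LL n ^ (m + 1)) F = 0) (j : ℕ) :
    ∃ c : ℂ, c ≠ 0 ∧ (LL n ^ (m + j)) (r2 n ^ j * F) = c • (LL n ^ m) F := by
  induction j with
  | zero => exact ⟨1, one_ne_zero, by simp⟩
  | succ j ih =>
    obtain ⟨c, hc, e⟩ := ih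
    refine ⟨((m + j + 1 : ℂ) * (2 * n + 4 * (m + j))) * c, mul_ne_zero ?_ hc, ?_⟩
    · have : (m + j + 1) * (2 * n + 4 * (m + j)) ≠ 0 := by positivity
      exact_mod_cast this
    · have h1 : (LL n ^ (m + j + 1)) (r2 n ^ j * F) = 0 := by
        have := LL_pow_r2_pow_mul_zero h0 j
        rwa [show m + 1 + j = m + j + 1 by omega] at this
      have h2 : EU n ((LL n ^ m) F) = 0 := by
        have := EU_homog (LL_pow_homog hF m).1
        simpa using this
      rw [pow_succ', mul_assoc, ← add_assoc, LL_pow_r2_mul, h1, e, map_smul, h2]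
      push_cast
      simp [smul_smul]

lemma key_bound {n : ℕ} (hn : 2 ≤ n) {k N : ℕ} {Q : MvPolynomial (Fin n) ℂ}
    (hC : ∀ (q : ℕ) (h : MvPolynomial (Fin n) ℂ), h.IsHomogeneous q → LL n h = 0 →
      (LL n ^ (N + 1)) (Q * h) = 0)
    {H : ℕ → MvPolynomial (Fin n) ℂ} {a : ℕ}
    (h1 : ∀ i, (H i).IsHomogeneous (k - 2 * i)) (h2 : ∀ i, LL n (H i) = 0)
    (h3 : ∀ i, k < 2 * i → H i = 0) (h4 : Q = ∑ i ∈ Finset.range a, r2 n ^ i * H i)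
    (i : ℕ) (hi : i < a) (hne : H i ≠ 0) : k - i ≤ N := by
  classical
  by_contra! hlt
  have hex : ∃ i, H i ≠ 0 := ⟨i, hne⟩
  obtain ⟨i0, hi0, hmin⟩ : ∃ i0, H i0 ≠ 0 ∧ ∀ j < i0, H j = 0 :=
    ⟨Nat.find hex, Nat.find_spec hex, fun j hj => by simpa using Nat.find_min hex hj⟩
  have hle : i0 ≤ i := by
    by_contra! hh; exact hne (hmin i hh)
  have hki : 2 * i0 ≤ k := by
    by_contra! hh; exact hi0 (h3 _ hh)
  set m := k - 2 * i0 with hm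
  have hcjh : LL n (cj (H i0)) = 0 := by rw [LL_cj, h2]; simp [cj]
  have hcjd : (cj (H i0)).IsHomogeneous m := (h1 i0).map _
  have z := LL_pow_zero_mono (hC m (cj (H i0)) hcjd hcjh) (show N + 1 ≤ m + i0 by omega)
  rw [h4, Finset.sum_mul, map_sum, Finset.sum_eq_single i0] at z
  · have hF : (H i0 * cj (H i0)).IsHomogeneous (2 * m) := by
      have := (h1 i0).mul hcjd
      rwa [← two_mul] at this
    obtain ⟨c, hc, e⟩ := LL_pow_r2_pow_mul_top hn hF (LL_pow_mul_harm m _ _ (h1 i0) hcjh) i0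
    rw [mul_assoc, e] at z
    obtain ⟨r, _, hr, hrp⟩ := LL_pow_HcjH m (H i0) (h1 i0) (h2 i0)
    rw [hr, smul_eq_C_mul, ← C_mul, C_eq_zero] at z
    have := hrp hi0
    rcases mul_eq_zero.mp z with z | z
    · exact hc z
    · norm_cast at z; exact this.ne' z
  · intro j _ hj
    rcases lt_or_gt_of_ne hj with hj | hj
    · rw [hmin j hj]; simp
    · by_cases hk : k < 2 * j
      · rw [h3 j hk]; simp
      · rw [mul_assoc]
        refine LL_pow_zero_mono (LL_pow_r2_pow_mul_zero (LL_pow_mul_harm _ _ _ (h1 j) hcjh) j) ?_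
        omega
  · intro hh
    exact absurd (Finset.mem_range.mpr (lt_of_le_of_lt hle hi)) hh

lemma comp_cond {n N : ℕ} {P : MvPolynomial (Fin n) ℂ}
    (hC : ∀ h : MvPolynomial (Fin n) ℂ, LL n h = 0 → (LL n ^ (N + 1)) (P * h) = 0) (k : ℕ)
    (q : ℕ) (h : MvPolynomial (Fin n) ℂ) (hq : h.IsHomogeneous q) (hh : LL n h = 0) :
      (LL n ^ (N + 1)) (homogeneousComponent k P * h) = 0 := by
  have hd : ∀ j, (homogeneousComponent j P * h).IsHomogeneous (j + q) := fun j =>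
    (homogeneousComponent_isHomogeneous j P).mul hq
  have hL := fun j => LL_pow_homog (hd j) (N + 1)
  by_cases hk : k + q < 2 * (N + 1)
  · exact (hL k).2 hk
  by_cases hkd : P.totalDegree < k
  · rw [homogeneousComponent_eq_zero _ _ hkd]; simp
  have z := hC h hh
  rw [← sum_homogeneousComponent P, Finset.sum_mul, map_sum] at z
  have z2 := congrArg (homogeneousComponent (k + q - 2 * (N + 1))) z
  rw [map_sum, map_zero, Finset.sum_eq_single k] at z2
  · rwa [homogeneousComponent_of_mem ((mem_homogeneousSubmodule _ _).mpr (hL k).1), if_pos rfl]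
      at z2
  · intro j _ hj
    by_cases hj2 : j + q < 2 * (N + 1)
    · rw [(hL j).2 hj2, map_zero]
    · rw [homogeneousComponent_of_mem ((mem_homogeneousSubmodule _ _).mpr (hL j).1), if_neg]
      omega
  · intro hh
    exact absurd (Finset.mem_range.mpr (by omega)) hh

/-- translation of polynomials -/
def tr {n : ℕ} (y : Fin n → ℂ) : MvPolynomial (Fin n) ℂ →ₐ[ℂ] MvPolynomial (Fin n) ℂ :=
  aeval (fun i => X i + C (y i))

lemma tr_tr {n : ℕ} (y : Fin n → ℂ) (P : MvPolynomial (Fin n) ℂ) : tr y (tr (-y) P) = P := by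
  have : (tr y).comp (tr (-y)) = AlgHom.id ℂ _ := by
    apply MvPolynomial.algHom_ext
    intro i
    simp [tr]
  exact congrArg (fun f => f P) this

lemma pderiv_tr {n : ℕ} (y : Fin n → ℂ) (i : Fin n) (P : MvPolynomial (Fin n) ℂ) :
    pderiv i (tr y P) = tr y (pderiv i P) := by
  classical
  induction P using MvPolynomial.induction_on with
  | C a => simp [tr, algebraMap_eq]
  | add p q hp hq => simp [hp, hq]
  | mul_X p j hp =>
    rw [map_mul, pderiv_mul, pderiv_mul, hp, map_add, map_mul, map_mul]
    congr 2
    rw [pderiv_X]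
    simp [tr, pderiv_X, Pi.single_apply]

lemma LL_pow_tr {n : ℕ} (y : Fin n → ℂ) (a : ℕ) (P : MvPolynomial (Fin n) ℂ) :
    (LL n ^ a) (tr y P) = tr y ((LL n ^ a) P) := by
  induction a with
  | zero => simp
  | succ a ih =>
    rw [pow_succ', Module.End.mul_apply, ih, Module.End.mul_apply]
    simp [LL_apply, pderiv_tr]

lemma tr_cond {n N : ℕ} {P : MvPolynomial (Fin n) ℂ}
    (hC : ∀ h : MvPolynomial (Fin n) ℂ, LL n h = 0 → (LL n ^ (N + 1)) (P * h) = 0)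
    (y : Fin n → ℂ) :
    ∀ h : MvPolynomial (Fin n) ℂ, LL n h = 0 → (LL n ^ (N + 1)) (tr y P * h) = 0 := by
  intro h hh
  rw [← tr_tr y h, ← map_mul, LL_pow_tr, hC, map_zero]
  have := LL_pow_tr (-y) 1 h
  rw [pow_one] at this
  rw [this, hh, map_zero]

lemma cond_of_NP {n : ℕ} (P : MvPolynomial (Fin n) ℂ) (NP : ℕ)
    (hNP : NP = sSup {d : ℕ | ∃ h : MvPolynomial (Fin n) ℂ,
      IsHarmonicPoly n h ∧ pdeg n (P * h) = d}) :
    ∀ h : MvPolynomial (Fin n) ℂ, LL n h = 0 → (LL n ^ (NP + 1)) (P * h) = 0 := by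
  have hb : ∀ h : MvPolynomial (Fin n) ℂ, LL n h = 0 →
      (LL n ^ (P.totalDegree + 1)) (P * h) = 0 := by
    intro h hh
    conv in P * h => rw [← sum_homogeneousComponent P]
    rw [Finset.sum_mul, map_sum]
    refine Finset.sum_eq_zero fun i hi => ?_
    exact LL_pow_zero_mono (LL_pow_mul_harm i _ _ (homogeneousComponent_isHomogeneous i P) hh)
      (by simp at hi; omega)
  have hbd : BddAbove {d : ℕ | ∃ h : MvPolynomial (Fin n) ℂ,
      IsHarmonicPoly n h ∧ pdeg n (P * h) = d} := by
    refine ⟨P.totalDegree, ?_⟩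
    rintro d ⟨h, hh, rfl⟩
    apply Nat.sInf_le
    rw [Set.mem_ofPred_eq, lap_iter]
    refine hb h ?_
    rw [← lap_eq]; exact hh
  intro h hh
  have hle : pdeg n (P * h) ≤ NP := by
    rw [hNP]
    refine le_csSup hbd ⟨h, ?_, rfl⟩
    rw [IsHarmonicPoly, lap_eq]; exact hh
  have hmem : pdeg n (P * h) ∈ {N : ℕ | (lap n)^[N + 1] (P * h) = 0} := by
    refine Nat.sInf_mem ⟨P.totalDegree, ?_⟩
    rw [Set.mem_ofPred_eq, lap_iter]
    exact hb h hh
  rw [Set.mem_ofPred_eq, lap_iter] at hmem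
  exact LL_pow_zero_mono hmem (by omega)

/-- Combined algebraic statement. -/
lemma decomp_main {n : ℕ} (hn : 2 ≤ n) {N : ℕ} {P : MvPolynomial (Fin n) ℂ}
    (hC : ∀ h : MvPolynomial (Fin n) ℂ, LL n h = 0 → (LL n ^ (N + 1)) (P * h) = 0)
    (y : Fin n → ℂ) :
    ∃ H : ℕ → ℕ → MvPolynomial (Fin n) ℂ,
      (∀ k i, H k i = 0 ∨ ∃ m, (H k i).IsHomogeneous m ∧ LL n (H k i) = 0 ∧
        (1 ≤ k → 1 ≤ i + m) ∧ i + m ≤ N) ∧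
      tr y P - C (eval y P) = ∑ k ∈ Finset.Icc 1 (tr y P).totalDegree,
        ∑ i ∈ Finset.range (k + 1), r2 n ^ i * H k i := by
  set Q := tr y P with hQ
  have hex : ∀ k, _ := fun k => almansi hn k (k + 1) (homogeneousComponent k Q)
    (homogeneousComponent_isHomogeneous k Q)
    ((LL_pow_homog (homogeneousComponent_isHomogeneous k Q) (k + 1)).2 (by omega))
  choose H h1 h2 h3 h4 using hex
  refine ⟨fun k i => if i < k + 1 then H k i else 0, ?_, ?_⟩
  · intro k i
    by_cases hik : i < k + 1
    swap
    · left; simp [hik]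
    simp only [hik, if_true]
    by_cases h0 : H k i = 0
    · left; exact h0
    · right
      have hki : 2 * i ≤ k := by
        by_contra! hh; exact h0 (h3 _ _ hh)
      have := key_bound hn (comp_cond (tr_cond hC y) k) (h1 k) (h2 k) (h3 k) (h4 k) i hik h0
      exact ⟨k - 2 * i, h1 k i, h2 k i, fun _ => by omega, by omega⟩
  · have e : ∀ k, ∑ i ∈ Finset.range (k + 1), r2 n ^ i * (if i < k + 1 then H k i else 0) =
        homogeneousComponent k Q := by
      intro k
      conv_rhs => rw [h4 k]
      refine Finset.sum_congr rfl fun i hi => ?_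
      rw [if_pos (Finset.mem_range.mp hi)]
    simp only [e]
    have hs := sum_homogeneousComponent Q
    have hc : homogeneousComponent 0 Q = C (eval y P) := by
      rw [homogeneousComponent_zero]
      congr 1
      rw [← constantCoeff_eq, hQ, tr, aeval_def, ← MvPolynomial.eval_zero]
      rw [hom_eval₂]
      congr 1
      · ext; simp
      · ext; simp
    rw [Finset.sum_range_succ', hc] at hs
    rw [sub_eq_iff_eq_add]
    conv_lhs => rw [← hs]
    rw [add_left_inj]
    rw [Finset.range_eq_Ico, Finset.sum_Ico_add' (fun k => homogeneousComponent k Q) 0 _ 1]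
    rfl

end

section

open scoped ContDiff

/-- kernel derivative -/
def pd {n : ℕ} (v : En n) (g : En n × En n → ℂ) : En n × En n → ℂ := fun p =>
  fderiv ℝ (fun x => g (x, p.2)) p.1 v

/-- Laplacian in the first variable -/
def plap (n : ℕ) (g : En n × En n → ℂ) : En n × En n → ℂ := fun p =>
  ∑ i : Fin n, pd (EuclideanSpace.single i (1 : ℝ)) (pd (EuclideanSpace.single i (1 : ℝ)) g) p

lemma plap_eq {n : ℕ} (g : En n × En n → ℂ) (x y : En n) :
    plap n g (x, y) = fnLap n (fun x => g (x, y)) x := rfl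

lemma plap_iter {n : ℕ} (N : ℕ) (g : En n × En n → ℂ) (x y : En n) :
    (plap n)^[N] g (x, y) = (fnLap n)^[N] (fun x => g (x, y)) x := by
  induction N generalizing x with
  | zero => rfl
  | succ N ih =>
    rw [Function.iterate_succ_apply', Function.iterate_succ_apply', plap_eq]
    congr 1
    funext x
    exact ih x

/-- domain -/
def UU (n : ℕ) : Set (En n × En n) := {p | ‖p.2‖ < ‖p.1‖}

lemma UU_open (n : ℕ) : IsOpen (UU n) :=
  isOpen_lt (continuous_snd.norm) (continuous_fst.norm)

lemma hasFDerivAt_slice {n : ℕ} {g : En n × En n → ℂ} (hg : ContDiffOn ℝ ∞ g (UU n))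
    {p : En n × En n} (hp : p ∈ UU n) :
    HasFDerivAt (fun x => g (x, p.2))
      ((fderiv ℝ g p).comp (ContinuousLinearMap.inl ℝ (En n) (En n))) p.1 := by
  have h1 : DifferentiableAt ℝ g p :=
    ((hg p hp).contDiffAt ((UU_open n).mem_nhds hp)).differentiableAt (by simp)
  have h2 : HasFDerivAt (fun x : En n => (x, p.2)) (ContinuousLinearMap.inl ℝ (En n) (En n)) p.1 :=
    hasFDerivAt_prodMk_left p.1 p.2
  exact HasFDerivAt.comp (g := g) p.1 h1.hasFDerivAt h2

lemma pd_contDiffOn {n : ℕ} (v : En n) {g : En n × En n → ℂ} (hg : ContDiffOn ℝ ∞ g (UU n)) :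
    ContDiffOn ℝ ∞ (pd v g) (UU n) := by
  have h1 : ContDiffOn ℝ ∞ (fun p => fderiv ℝ g p (v, 0)) (UU n) :=
    (hg.fderiv_of_isOpen (UU_open n) (by simp)).clm_apply contDiffOn_const
  refine h1.congr fun p hp => ?_
  rw [pd, (hasFDerivAt_slice hg hp).fderiv]
  simp

lemma plap_contDiffOn {n : ℕ} {g : En n × En n → ℂ} (hg : ContDiffOn ℝ ∞ g (UU n)) :
    ContDiffOn ℝ ∞ (plap n g) (UU n) :=
  ContDiffOn.sum fun _ _ => pd_contDiffOn _ (pd_contDiffOn _ hg)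

lemma integrable_slice {n : ℕ} {F : Type*} [NormedAddCommGroup F] [NormedSpace ℝ F]
    {g : En n × En n → F} (hg : ContinuousOn g (UU n))
    {R : ℝ} {ν : Measure (En n)} [IsFiniteMeasure ν] (hν : ∀ᵐ y ∂ν, y ∈ closedBall (0 : En n) R)
    {x : En n} (hx : R < ‖x‖) : Integrable (fun y => g (x, y)) ν := by
  have h1 : ContinuousOn (fun y => g (x, y)) (closedBall (0 : En n) R) := by
    refine hg.comp (by fun_prop) fun y hy => ?_
    simp only [mem_closedBall, dist_zero_right] at hy
    exact lt_of_le_of_lt hy hx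
  have := h1.integrableOn_compact (μ := ν) (isCompact_closedBall _ _)
  rwa [IntegrableOn, Measure.restrict_eq_self_of_ae_mem hν] at this

lemma hasFDerivAt_int {n : ℕ} {g : En n × En n → ℂ} (hg : ContDiffOn ℝ ∞ g (UU n))
    {R : ℝ} {ν : Measure (En n)} [IsFiniteMeasure ν] (hν : ∀ᵐ y ∂ν, y ∈ closedBall (0 : En n) R)
    {x : En n} (hx : R < ‖x‖) :
    HasFDerivAt (fun x => ∫ y, g (x, y) ∂ν)
      (∫ y, (fderiv ℝ g (x, y)).comp (ContinuousLinearMap.inl ℝ (En n) (En n)) ∂ν) x := by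
  have hc : ContinuousOn (fun p => (fderiv ℝ g p).comp
      (ContinuousLinearMap.inl ℝ (En n) (En n))) (UU n) :=
    (hg.continuousOn_fderiv_of_isOpen (UU_open n) (by simp)).clm_comp continuousOn_const
  obtain ⟨ε, hε, hsub⟩ : ∃ ε > 0, closedBall x ε ⊆ {z : En n | R < ‖z‖} := by
    have : {z : En n | R < ‖z‖} ∈ nhds x := (isOpen_lt continuous_const continuous_norm).mem_nhds hx
    exact Metric.nhds_basis_closedBall.mem_iff.mp this
  have hsubU : closedBall x ε ×ˢ closedBall (0 : En n) R ⊆ UU n := by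
    rintro ⟨a, b⟩ ⟨ha, hb⟩
    simp only [mem_closedBall, dist_zero_right] at hb
    exact lt_of_le_of_lt hb (hsub ha)
  obtain ⟨B, hB⟩ := ((isCompact_closedBall x ε).prod (isCompact_closedBall (0 : En n) R)).exists_bound_of_continuousOn
    (hc.mono hsubU)
  refine hasFDerivAt_integral_of_dominated_of_fderiv_le (s := closedBall x ε) (bound := fun _ => B)
    (F' := fun x y => (fderiv ℝ g (x, y)).comp (ContinuousLinearMap.inl ℝ (En n) (En n)))
    (closedBall_mem_nhds x hε) ?_ (integrable_slice hg.continuousOn hν hx)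
    (integrable_slice hc hν hx).aestronglyMeasurable ?_ (integrable_const _) ?_
  · filter_upwards [closedBall_mem_nhds x hε] with z hz
    exact (integrable_slice hg.continuousOn hν (hsub hz)).aestronglyMeasurable
  · filter_upwards [hν] with y hy z hz
    exact hB (z, y) ⟨hz, hy⟩
  · filter_upwards [hν] with y hy z hz
    exact hasFDerivAt_slice hg (hsubU (Set.mk_mem_prod hz hy))

lemma fderiv_int {n : ℕ} {g : En n × En n → ℂ} (hg : ContDiffOn ℝ ∞ g (UU n))
    {R : ℝ} {ν : Measure (En n)} [IsFiniteMeasure ν] (hν : ∀ᵐ y ∂ν, y ∈ closedBall (0 : En n) R)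
    {x : En n} (hx : R < ‖x‖) (v : En n) :
    (∫ y, (fderiv ℝ g (x, y)).comp (ContinuousLinearMap.inl ℝ (En n) (En n)) ∂ν) v =
      ∫ y, pd v g (x, y) ∂ν := by
  have hc : ContinuousOn (fun p => (fderiv ℝ g p).comp
      (ContinuousLinearMap.inl ℝ (En n) (En n))) (UU n) :=
    (hg.continuousOn_fderiv_of_isOpen (UU_open n) (by simp)).clm_comp continuousOn_const
  rw [ContinuousLinearMap.integral_apply (integrable_slice hc hν hx)]
  refine integral_congr_ae ?_
  filter_upwards [hν] with y hy
  have hp : (x, y) ∈ UU n := by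
    simp only [mem_closedBall, dist_zero_right] at hy
    exact lt_of_le_of_lt hy hx
  rw [pd, (hasFDerivAt_slice hg hp).fderiv]

lemma Ker_pd {n : ℕ} {g : En n × En n → ℂ} (hg : ContDiffOn ℝ ∞ g (UU n)) (c : ℂ)
    {R : ℝ} {ν ν' : Measure (En n)} [IsFiniteMeasure ν] [IsFiniteMeasure ν']
    (hν : ∀ᵐ y ∂ν, y ∈ closedBall (0 : En n) R) (hν' : ∀ᵐ y ∂ν', y ∈ closedBall (0 : En n) R)
    {f : En n → ℂ} (hf : ∀ x, R < ‖x‖ → f x = c * (∫ y, g (x, y) ∂ν - ∫ y, g (x, y) ∂ν'))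
    (v : En n) {x : En n} (hx : R < ‖x‖) :
    fderiv ℝ f x v = c * (∫ y, pd v g (x, y) ∂ν - ∫ y, pd v g (x, y) ∂ν') := by
  have hV : {z : En n | R < ‖z‖} ∈ nhds x := (isOpen_lt continuous_const continuous_norm).mem_nhds hx
  have he : f =ᶠ[nhds x] fun x => c * (∫ y, g (x, y) ∂ν - ∫ y, g (x, y) ∂ν') := by
    filter_upwards [hV] with z hz using hf z hz
  rw [he.fderiv_eq]
  rw [(((hasFDerivAt_int hg hν hx).fun_sub (hasFDerivAt_int hg hν' hx)).const_mul c).fderiv]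
  rw [← fderiv_int hg hν hx v, ← fderiv_int hg hν' hx v]
  simp

lemma Ker_lap {n : ℕ} {g : En n × En n → ℂ} (hg : ContDiffOn ℝ ∞ g (UU n)) (c : ℂ)
    {R : ℝ} {ν ν' : Measure (En n)} [IsFiniteMeasure ν] [IsFiniteMeasure ν']
    (hν : ∀ᵐ y ∂ν, y ∈ closedBall (0 : En n) R) (hν' : ∀ᵐ y ∂ν', y ∈ closedBall (0 : En n) R)
    {f : En n → ℂ} (hf : ∀ x, R < ‖x‖ → f x = c * (∫ y, g (x, y) ∂ν - ∫ y, g (x, y) ∂ν'))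
    {x : En n} (hx : R < ‖x‖) :
    fnLap n f x = c * (∫ y, plap n g (x, y) ∂ν - ∫ y, plap n g (x, y) ∂ν') := by
  have hi : ∀ (i : Fin n), ContDiffOn ℝ ∞ (pd (EuclideanSpace.single i (1 : ℝ))
    (pd (EuclideanSpace.single i (1 : ℝ)) g)) (UU n) := fun i => pd_contDiffOn _ (pd_contDiffOn _ hg)
  simp only [plap]
  rw [integral_finsetSum _ fun i _ => integrable_slice (hi i).continuousOn hν hx,
    integral_finsetSum _ fun i _ => integrable_slice (hi i).continuousOn hν' hx,
    ← Finset.sum_sub_distrib, Finset.mul_sum, fnLap]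
  refine Finset.sum_congr rfl fun i _ => ?_
  exact Ker_pd (pd_contDiffOn _ hg) c hν hν' (fun z hz => Ker_pd hg c hν hν' hf _ hz) _ hx

lemma Ker_iter {n : ℕ} {g : En n × En n → ℂ} (hg : ContDiffOn ℝ ∞ g (UU n)) (c : ℂ)
    {R : ℝ} {ν ν' : Measure (En n)} [IsFiniteMeasure ν] [IsFiniteMeasure ν']
    (hν : ∀ᵐ y ∂ν, y ∈ closedBall (0 : En n) R) (hν' : ∀ᵐ y ∂ν', y ∈ closedBall (0 : En n) R)
    {f : En n → ℂ} (hf : ∀ x, R < ‖x‖ → f x = c * (∫ y, g (x, y) ∂ν - ∫ y, g (x, y) ∂ν'))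
    (N : ℕ) : ∀ x, R < ‖x‖ → (fnLap n)^[N] f x =
      c * (∫ y, (plap n)^[N] g (x, y) ∂ν - ∫ y, (plap n)^[N] g (x, y) ∂ν') := by
  induction N generalizing f g with
  | zero => simpa using hf
  | succ N ih =>
    rw [Function.iterate_succ, Function.iterate_succ]
    exact ih (plap_contDiffOn hg) fun x hx => Ker_lap hg c hν hν' hf hx

end

section

open scoped ContDiff

lemma evalR_contDiff {n : ℕ} (Q : MvPolynomial (Fin n) ℂ) : ContDiff ℝ ∞ (evalR Q) := by
  induction Q using MvPolynomial.induction_on with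
  | C a =>
    have : (evalR (C a) : En n → ℂ) = fun _ => a := by funext x; simp [evalR]
    rw [this]; exact contDiff_const
  | add p q hp hq =>
    have : (evalR (p + q) : En n → ℂ) = fun x => evalR p x + evalR q x := by
      funext x; simp [evalR]
    rw [this]; exact hp.add hq
  | mul_X p i hp =>
    have : (evalR (p * X i) : En n → ℂ) = fun x => evalR p x * (x i : ℂ) := by
      funext x; simp [evalR]
    rw [this]
    refine hp.mul (Complex.ofRealCLM.contDiff.comp ?_)
    fun_prop

lemma evalR_differentiable {n : ℕ} (Q : MvPolynomial (Fin n) ℂ) : Differentiable ℝ (evalR Q) :=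
  (evalR_contDiff Q).differentiable (by simp)

lemma evalR_fderiv {n : ℕ} (i : Fin n) (x : En n) (Q : MvPolynomial (Fin n) ℂ) :
    fderiv ℝ (evalR Q) x (EuclideanSpace.single i (1 : ℝ)) = evalR (pderiv i Q) x := by
  classical
  induction Q using MvPolynomial.induction_on with
  | C a =>
    have : (evalR (C a) : En n → ℂ) = fun _ => a := by funext x; simp [evalR]
    rw [this]; simp [evalR]
  | add p q hp hq =>
    have : (evalR (p + q) : En n → ℂ) = fun x => evalR p x + evalR q x := by
      funext x; simp [evalR]
    rw [this, fderiv_fun_add (evalR_differentiable p x) (evalR_differentiable q x)]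
    simp [hp, hq]; simp [evalR]
  | mul_X p j hp =>
    have : (evalR (p * X j) : En n → ℂ) = fun x => evalR p x * (x j : ℂ) := by
      funext x; simp [evalR]
    have hX : HasFDerivAt (fun x : En n => (x j : ℂ))
        (Complex.ofRealCLM.comp (EuclideanSpace.proj j : En n →L[ℝ] ℝ)) x :=
      (Complex.ofRealCLM.comp (EuclideanSpace.proj j : En n →L[ℝ] ℝ)).hasFDerivAt
    rw [this, ((evalR_differentiable p x).hasFDerivAt.fun_mul hX).fderiv]
    simp only [ContinuousLinearMap.add_apply, ContinuousLinearMap.smul_apply, hp]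
    simp only [pderiv_mul, pderiv_X, evalR, map_add, map_mul, eval_X, Pi.single_apply]
    by_cases hij : i = j
    · subst hij; simp; ring
    · simp [hij, Ne.symm hij]; ring

/-- basic function -/
def Ph {n : ℕ} (t : ℝ) (Q : MvPolynomial (Fin n) ℂ) (z : En n) : ℂ :=
  (((‖z‖ ^ 2) ^ t : ℝ) : ℂ) * evalR Q z

lemma Ph_contDiffAt {n : ℕ} (t : ℝ) (Q : MvPolynomial (Fin n) ℂ) {z : En n} (hz : z ≠ 0) :
    ContDiffAt ℝ ∞ (Ph t Q) z := by
  refine ContDiffAt.mul ?_ (evalR_contDiff Q).contDiffAt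
  refine Complex.ofRealCLM.contDiff.contDiffAt.comp z ?_
  refine ContDiffAt.rpow_const_of_ne (contDiff_norm_sq ℝ).contDiffAt ?_
  simpa using hz

lemma Ph_differentiableAt {n : ℕ} (t : ℝ) (Q : MvPolynomial (Fin n) ℂ) {z : En n} (hz : z ≠ 0) :
    DifferentiableAt ℝ (Ph t Q) z := (Ph_contDiffAt t Q hz).differentiableAt (by simp)

lemma Ph_fderiv {n : ℕ} (t : ℝ) (Q : MvPolynomial (Fin n) ℂ) {z : En n} (hz : z ≠ 0) (i : Fin n) :
    fderiv ℝ (Ph t Q) z (EuclideanSpace.single i (1 : ℝ)) =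
      Ph (t - 1) (C (2 * t : ℂ) * (X i * Q)) z + Ph t (pderiv i Q) z := by
  have hw : ‖z‖ ^ 2 ≠ 0 := by simpa using hz
  have h1 : HasFDerivAt (fun z : En n => (‖z‖ ^ 2) ^ t) _ z :=
    (hasStrictFDerivAt_norm_sq z).hasFDerivAt.rpow_const (p := t) (Or.inl hw)
  have h2 : HasFDerivAt (fun z : En n => (((‖z‖ ^ 2) ^ t : ℝ) : ℂ)) _ z :=
    Complex.ofRealCLM.hasFDerivAt.comp z h1
  have h3 := h2.mul (evalR_differentiable Q z).hasFDerivAt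
  have : Ph t Q = (fun z : En n => (((‖z‖ ^ 2) ^ t : ℝ) : ℂ)) * evalR Q := rfl
  rw [this, h3.fderiv]
  simp only [ContinuousLinearMap.add_apply, ContinuousLinearMap.smul_apply, evalR_fderiv, Ph]
  have : inner ℝ z (EuclideanSpace.single i (1 : ℝ)) = z i := by
    simp [EuclideanSpace.inner_single_right]
  simp [this, evalR]
  ring

lemma Ph_add {n : ℕ} (t : ℝ) (Q Q' : MvPolynomial (Fin n) ℂ) (z : En n) :
    Ph t (Q + Q') z = Ph t Q z + Ph t Q' z := by
  simp [Ph, evalR, mul_add]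

lemma Ph_sum {n : ℕ} {ι : Type*} (s : Finset ι) (t : ℝ) (Q : ι → MvPolynomial (Fin n) ℂ)
    (z : En n) : Ph t (∑ i ∈ s, Q i) z = ∑ i ∈ s, Ph t (Q i) z := by
  simp [Ph, evalR, Finset.mul_sum]

lemma evalR_r2 {n : ℕ} (z : En n) : evalR (r2 n) z = ((‖z‖ ^ 2 : ℝ) : ℂ) := by
  rw [EuclideanSpace.norm_sq_eq]
  simp [evalR, r2]

lemma Ph_r2 {n : ℕ} (t : ℝ) (Q : MvPolynomial (Fin n) ℂ) {z : En n} (hz : z ≠ 0) :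
    Ph t (r2 n * Q) z = Ph (t + 1) Q z := by
  have hw : 0 < ‖z‖ ^ 2 := by positivity
  have h : evalR (r2 n * Q) z = evalR (r2 n) z * evalR Q z := by simp [evalR]
  rw [Ph, Ph, h, evalR_r2, Real.rpow_add hw, Real.rpow_one]
  push_cast; ring

lemma Ph_r2_pow {n : ℕ} (i : ℕ) (t : ℝ) (Q : MvPolynomial (Fin n) ℂ) {z : En n} (hz : z ≠ 0) :
    Ph t (r2 n ^ i * Q) z = Ph (t + i) Q z := by
  induction i generalizing t with
  | zero => simp
  | succ i ih =>
    rw [pow_succ', mul_assoc, Ph_r2 _ _ hz, ih]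
    push_cast; congr 1; ring

lemma ne_zero_nhds {n : ℕ} {z : En n} (hz : z ≠ 0) : ∀ᶠ w in nhds z, w ≠ 0 :=
  isOpen_ne.mem_nhds hz

lemma Ph_fnLap {n : ℕ} (t : ℝ) (Q : MvPolynomial (Fin n) ℂ) {z : En n} (hz : z ≠ 0) :
    fnLap n (Ph t Q) z = Ph (t - 1) ((2 * t * (2 * t - 2 + n) : ℂ) • Q + (4 * t : ℂ) • EU n Q) z +
      Ph t (LL n Q) z := by
  have h1 : ∀ i : Fin n, fderiv ℝ (fun y => fderiv ℝ (Ph t Q) y (EuclideanSpace.single i (1 : ℝ))) z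
      (EuclideanSpace.single i (1 : ℝ)) =
      Ph (t - 1 - 1) ((4 * t * (t - 1) : ℂ) • (X i ^ 2 * Q)) z +
      Ph (t - 1) ((2 * t : ℂ) • Q + (4 * t : ℂ) • (X i * pderiv i Q)) z +
      Ph t (pderiv i (pderiv i Q)) z := by
    intro i
    have he : (fun y => fderiv ℝ (Ph t Q) y (EuclideanSpace.single i (1 : ℝ))) =ᶠ[nhds z]
        fun z => Ph (t - 1) (C (2 * t : ℂ) * (X i * Q)) z + Ph t (pderiv i Q) z := by
      filter_upwards [ne_zero_nhds hz] with w hw using Ph_fderiv t Q hw i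
    rw [he.fderiv_eq, fderiv_fun_add (Ph_differentiableAt _ _ hz) (Ph_differentiableAt _ _ hz)]
    rw [ContinuousLinearMap.add_apply, Ph_fderiv _ _ hz, Ph_fderiv _ _ hz]
    simp only [pderiv_C_mul, pderiv_mul, pderiv_X_self]
    simp [Ph, evalR]
    ring
  rw [fnLap]
  simp only [h1, Finset.sum_add_distrib, ← Ph_sum, ← LL_apply]
  congr 1
  rw [← Finset.smul_sum, ← Finset.smul_sum, ← Finset.smul_sum, ← Finset.sum_mul, ← EU_apply]
  have : (∑ i : Fin n, (X i : MvPolynomial (Fin n) ℂ) ^ 2) = r2 n := rfl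
  rw [this, ← mul_smul_comm, Ph_r2 _ _ hz, sub_add_cancel, ← Ph_add]
  congr 1
  simp only [Finset.sum_const, Finset.card_univ, Fintype.card_fin]
  rw [← Nat.cast_smul_eq_nsmul ℂ]
  module

lemma Ph_fnLap_harm {n m : ℕ} (t : ℝ) {Q : MvPolynomial (Fin n) ℂ} (hQ : Q.IsHomogeneous m)
    (hh : LL n Q = 0) {z : En n} (hz : z ≠ 0) :
    fnLap n (Ph t Q) z = Ph (t - 1) ((2 * t * (2 * t - 2 + n + 2 * m) : ℂ) • Q) z := by
  rw [Ph_fnLap _ _ hz, hh, EU_homog hQ]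
  have : Ph t 0 z = 0 := by simp [Ph, evalR]
  rw [this, add_zero]
  congr 1
  module

lemma fnLap_congr {n : ℕ} {V : Set (En n)} (hV : IsOpen V) {f g : En n → ℂ}
    (h : ∀ x ∈ V, f x = g x) : ∀ x ∈ V, fnLap n f x = fnLap n g x := by
  have key : ∀ {f g : En n → ℂ} (v : En n), (∀ x ∈ V, f x = g x) →
      ∀ x ∈ V, fderiv ℝ f x v = fderiv ℝ g x v := by
    intro f g v h x hx
    have : f =ᶠ[nhds x] g := by filter_upwards [hV.mem_nhds hx] with z hz using h z hz
    rw [this.fderiv_eq]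
  intro x hx
  exact Finset.sum_congr rfl fun i _ => key _ (key _ h) x hx

lemma fnLap_iter_congr {n : ℕ} {V : Set (En n)} (hV : IsOpen V) (N : ℕ) {f g : En n → ℂ}
    (h : ∀ x ∈ V, f x = g x) : ∀ x ∈ V, (fnLap n)^[N] f x = (fnLap n)^[N] g x := by
  induction N generalizing f g with
  | zero => exact h
  | succ N ih => exact ih (fnLap_congr hV h)

lemma fd_contDiffOn {n : ℕ} {V : Set (En n)} (hV : IsOpen V) {f : En n → ℂ}
    (hf : ContDiffOn ℝ ∞ f V) (v : En n) : ContDiffOn ℝ ∞ (fun x => fderiv ℝ f x v) V :=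
  (hf.fderiv_of_isOpen hV (by simp)).clm_apply contDiffOn_const

lemma fnLap_contDiffOn {n : ℕ} {V : Set (En n)} (hV : IsOpen V) {f : En n → ℂ}
    (hf : ContDiffOn ℝ ∞ f V) : ContDiffOn ℝ ∞ (fnLap n f) V :=
  ContDiffOn.sum fun _ _ => fd_contDiffOn hV (fd_contDiffOn hV hf _) _

lemma cdo_diffAt {n : ℕ} {V : Set (En n)} (hV : IsOpen V) {f : En n → ℂ}
    (hf : ContDiffOn ℝ ∞ f V) {x : En n} (hx : x ∈ V) : DifferentiableAt ℝ f x :=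
  ((hf x hx).contDiffAt (hV.mem_nhds hx)).differentiableAt (by simp)

lemma fnLap_sum {n : ℕ} {V : Set (En n)} (hV : IsOpen V) {ι : Type*} (s : Finset ι)
    {f : ι → En n → ℂ} (hf : ∀ j ∈ s, ContDiffOn ℝ ∞ (f j) V) :
    ∀ x ∈ V, fnLap n (fun x => ∑ j ∈ s, f j x) x = ∑ j ∈ s, fnLap n (f j) x := by
  intro x hx
  simp only [fnLap]
  rw [Finset.sum_comm]
  refine Finset.sum_congr rfl fun i _ => ?_
  have he : (fun y => fderiv ℝ (fun x => ∑ j ∈ s, f j x) y (EuclideanSpace.single i (1 : ℝ)))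
      =ᶠ[nhds x] fun y => ∑ j ∈ s, fderiv ℝ (f j) y (EuclideanSpace.single i (1 : ℝ)) := by
    filter_upwards [hV.mem_nhds hx] with z hz
    rw [fderiv_fun_sum fun j hj => cdo_diffAt hV (hf j hj) hz]
    simp
  rw [he.fderiv_eq, fderiv_fun_sum fun j hj => cdo_diffAt hV (fd_contDiffOn hV (hf j hj) _) hx]
  simp

lemma fnLap_iter_sum {n : ℕ} {V : Set (En n)} (hV : IsOpen V) {ι : Type*} (s : Finset ι) (N : ℕ)
    {f : ι → En n → ℂ} (hf : ∀ j ∈ s, ContDiffOn ℝ ∞ (f j) V) :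
    ∀ x ∈ V, (fnLap n)^[N] (fun x => ∑ j ∈ s, f j x) x = ∑ j ∈ s, (fnLap n)^[N] (f j) x := by
  induction N generalizing f with
  | zero => intro x _; rfl
  | succ N ih =>
    intro x hx
    simp only [Function.iterate_succ, Function.comp]
    rw [← ih (fun j hj => fnLap_contDiffOn hV (hf j hj)) x hx]
    exact fnLap_iter_congr hV N (fnLap_sum hV s hf) x hx

lemma Ph_iter_zero {n m : ℕ} (N : ℕ) {i : ℕ} (hi : i < N) (t : ℝ) {Q : MvPolynomial (Fin n) ℂ}
    (hQ : Q.IsHomogeneous m) (hh : LL n Q = 0) (ht : 2 * (t - i) - 2 + n + 2 * m = 0)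
    {z : En n} (hz : z ≠ 0) : (fnLap n)^[N] (Ph t Q) z = 0 := by
  induction N generalizing i t Q with
  | zero => omega
  | succ N ih =>
    rw [Function.iterate_succ, Function.comp,
      fnLap_iter_congr (isOpen_ne (x := (0 : En n))) N
        (fun x hx => Ph_fnLap_harm t hQ hh hx) z hz]
    rcases Nat.eq_zero_or_pos i with rfl | hpos
    · have e : ((2 * t * (2 * t - 2 + n + 2 * m) : ℂ) • Q) = 0 := by
        have : (2 * t - 2 + n + 2 * m : ℂ) = 0 := by
          simp only [Nat.cast_zero, sub_zero] at ht; exact_mod_cast ht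
        rw [this]; simp
      rw [e]
      clear ih
      have h0 : (Ph (t - 1) 0 : En n → ℂ) = 0 := by funext z; simp [Ph, evalR]
      rw [h0]
      have h1 : fnLap n 0 = 0 := by
        funext z; simp [fnLap]
      rw [Function.iterate_fixed h1]; rfl
    · refine ih (i := i - 1) (by omega) (t - 1) ?_ ?_ ?_
      · rw [smul_eq_C_mul]; exact hQ.C_mul _
      · rw [map_smul, hh, smul_zero]
      · rw [Nat.cast_sub hpos]; push_cast; linarith

lemma fnLap_shift {n : ℕ} (y : En n) (f : En n → ℂ) :
    fnLap n (fun x => f (x - y)) = fun x => fnLap n f (x - y) := by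
  funext x
  simp only [fnLap]
  refine Finset.sum_congr rfl fun i _ => ?_
  simp only [fderiv_comp_sub]
  rw [fderiv_comp_sub (f := fun z => fderiv ℝ f z (EuclideanSpace.single i (1 : ℝ)))]

lemma fnLap_iter_shift {n : ℕ} (y : En n) (N : ℕ) (f : En n → ℂ) :
    (fnLap n)^[N] (fun x => f (x - y)) = fun x => (fnLap n)^[N] f (x - y) := by
  induction N generalizing f with
  | zero => rfl
  | succ N ih =>
    rw [Function.iterate_succ, Function.comp, fnLap_shift, ih]; rfl

/-- the real kernel -/
def kern (n : ℕ) (P : MvPolynomial (Fin n) ℂ) (p : En n × En n) : ℂ :=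
  (((‖p.1 - p.2‖ ^ 2) ^ (-(n : ℝ) / 2) : ℝ) : ℂ) * (evalR P p.1 - evalR P p.2)

lemma UU_ne {n : ℕ} {p : En n × En n} (hp : p ∈ UU n) : p.1 - p.2 ≠ 0 := by
  intro h
  rw [sub_eq_zero] at h
  have : ‖p.2‖ < ‖p.1‖ := hp
  rw [h] at this
  exact lt_irrefl _ this

lemma kern_contDiffOn (n : ℕ) (P : MvPolynomial (Fin n) ℂ) : ContDiffOn ℝ ∞ (kern n P) (UU n) := by
  intro p hp
  apply ContDiffAt.contDiffWithinAt
  refine ContDiffAt.mul ?_ ?_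
  · refine Complex.ofRealCLM.contDiff.contDiffAt.comp p ?_
    refine ContDiffAt.rpow_const_of_ne (((contDiff_norm_sq ℝ).comp
      (contDiff_fst.sub contDiff_snd)).contDiffAt) ?_
    simpa using UU_ne hp
  · exact (((evalR_contDiff P).comp contDiff_fst).sub
      ((evalR_contDiff P).comp contDiff_snd)).contDiffAt

lemma kern_polyharm {n : ℕ} (hn : 2 ≤ n) {N : ℕ} {P : MvPolynomial (Fin n) ℂ}
    (hC : ∀ h : MvPolynomial (Fin n) ℂ, LL n h = 0 → (LL n ^ (N + 1)) (P * h) = 0)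
    {x y : En n} (hxy : x - y ≠ 0) : (fnLap n)^[N] (fun x => kern n P (x, y)) x = 0 := by
  set y' : Fin n → ℂ := fun i => (y i : ℂ)
  have h1 : (fun x => kern n P (x, y)) =
      fun x => Ph (-(n : ℝ) / 2) (tr y' P - C (eval y' P)) (x - y) := by
    funext x
    simp only [kern, Ph]
    congr 1
    simp only [evalR, map_sub, eval_C]
    congr 1
    rw [tr, aeval_def, ← coe_eval₂Hom, ← RingHom.comp_apply]
    congr 1
    ext i
    · simp
    · simp [y']
  rw [h1, fnLap_iter_shift]
  beta_reduce
  obtain ⟨H, hH, e⟩ := decomp_main hn hC y'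
  rw [e]
  set z := x - y
  have hV := isOpen_ne (x := (0 : En n))
  rw [fnLap_iter_congr hV N (g := fun z => ∑ p ∈ (Finset.Icc 1 (tr y' P).totalDegree).sigma
      (fun k => Finset.range (k + 1)), Ph (-(n : ℝ) / 2 + p.2) (H p.1 p.2) z) ?_ z hxy]
  · rw [fnLap_iter_sum hV _ N ?_ z hxy]
    · refine Finset.sum_eq_zero fun p hp => ?_
      obtain ⟨k, i⟩ := p
      simp only [Finset.mem_sigma, Finset.mem_Icc] at hp
      rcases hH k i with h0 | ⟨m, hm, hh, ha, hb⟩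
      · simp only [h0]
        have h0 : (Ph (-(n : ℝ) / 2 + i) 0 : En n → ℂ) = 0 := by funext z; simp [Ph, evalR]
        have h1 : fnLap n 0 = 0 := by
          funext z; simp [fnLap]
        rw [h0, Function.iterate_fixed h1]; rfl
      · have := ha hp.1.1
        refine Ph_iter_zero N (i := i + m - 1) (by omega) _ hm hh ?_ hxy
        rw [Nat.cast_sub this]; push_cast; ring
    · intro p _ w hw
      exact (Ph_contDiffAt _ _ hw).contDiffWithinAt
  · intro w hw
    rw [Finset.sum_sigma, Ph_sum]
    refine Finset.sum_congr rfl fun k _ => ?_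
    rw [Ph_sum]
    exact Finset.sum_congr rfl fun i _ => Ph_r2_pow _ _ _ hw

lemma qP_integrand {n : ℕ} (hn : 2 ≤ n) (P : MvPolynomial (Fin n) ℂ) {x y : En n}
    (hxy : ‖y‖ < ‖x‖) :
    (‖x‖ : ℂ) ^ ((1 : ℤ) - n) * ((evalC P (‖x‖ : ℂ) (‖x‖⁻¹ • x) - evalR P y) * (‖x‖ : ℂ) ^ (n - 1) /
      rPow n (‖x‖ : ℂ) (‖x‖⁻¹ • x) y) = kern n P (x, y) := by
  have hx : 0 < ‖x‖ := lt_of_le_of_lt (norm_nonneg _) hxy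
  have hxc : (‖x‖ : ℂ) ≠ 0 := by exact_mod_cast hx.ne'
  have h1 : evalC P (‖x‖ : ℂ) (‖x‖⁻¹ • x) = evalR P x := by
    simp only [evalC, evalR]
    congr 2
    funext i
    simp [mul_inv_cancel_left₀ hxc]
  have hne : x - y ≠ 0 := UU_ne (p := (x, y)) hxy
  have hpos : 0 < ‖x - y‖ ^ 2 := by positivity
  have h2 : rPow n (‖x‖ : ℂ) (‖x‖⁻¹ • x) y = (((‖x - y‖ ^ 2) ^ ((n : ℝ) / 2) : ℝ) : ℂ) := by
    have hb : (1 - 2 * ((inner ℝ (‖x‖⁻¹ • x) y : ℝ) : ℂ) / (‖x‖ : ℂ) + ((‖y‖ : ℂ)) ^ 2 / (‖x‖ : ℂ) ^ 2) =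
        ((‖x - y‖ ^ 2 / ‖x‖ ^ 2 : ℝ) : ℂ) := by
      rw [norm_sub_sq_real, real_inner_smul_left]
      push_cast
      field_simp
    rw [rPow, hb]
    have : ((n : ℂ) / 2) = (((n : ℝ) / 2 : ℝ) : ℂ) := by push_cast; rfl
    rw [this, ← Complex.ofReal_cpow (by positivity), Real.div_rpow (by positivity) (by positivity)]
    have : (‖x‖ ^ 2) ^ ((n : ℝ) / 2) = ‖x‖ ^ n := by
      rw [← Real.rpow_natCast, ← Real.rpow_mul hx.le, ← Real.rpow_natCast]
      congr 1; push_cast; ring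
    rw [this]
    push_cast
    field_simp
  have h3 : (‖x‖ : ℂ) ^ ((1 : ℤ) - n) * (‖x‖ : ℂ) ^ (n - 1) = 1 := by
    rw [← zpow_natCast, ← zpow_add₀ hxc, Nat.cast_sub (by omega)]
    simp
  rw [h1, h2, kern, neg_div, Real.rpow_neg hpos.le]
  push_cast
  rw [div_eq_mul_inv]
  linear_combination (evalR P x - evalR P y) * (((‖x - y‖ ^ 2) ^ ((n : ℝ) / 2) : ℝ) : ℂ)⁻¹ * h3

end

/-- The function `rθ ↦ r^{-(n-1)} Q_P(r,θ)` is polyharmonic of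
degree `< N_P` on `{|x| > R}`, i.e. `Δ^{N_P}` of it vanishes there. -/
theorem secondKind_is_polyharmonic
    (n : ℕ) (hn : 2 ≤ n) (R : ℝ) (hR : 0 ≤ R)
    (μ : SignedMeasure (En n)) (hμ : SuppIn μ (closedBall (0 : En n) R))
    (P : MvPolynomial (Fin n) ℂ)
    (NP : ℕ)
    (hNP : NP = sSup {d : ℕ | ∃ h : MvPolynomial (Fin n) ℂ,
      IsHarmonicPoly n h ∧ pdeg n (P * h) = d})
    (f : En n → ℂ)
    (hf : ∀ x : En n, f x = ((‖x‖ : ℂ)) ^ ((1 : ℤ) - n) *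
      qP μ P ((‖x‖ : ℝ) : ℂ) (‖x‖⁻¹ • x)) :
    ∀ x : En n, R < ‖x‖ → (fnLap n)^[NP] f x = 0 := by
  have hC := cond_of_NP P NP hNP
  have hs : μ.toJordanDecomposition.posPart (closedBall (0 : En n) R)ᶜ = 0 ∧
      μ.toJordanDecomposition.negPart (closedBall (0 : En n) R)ᶜ = 0 := by
    have h := hμ
    rw [SuppIn, SignedMeasure.totalVariation, Measure.coe_add, Pi.add_apply, add_eq_zero] at h
    exact h
  have hν : ∀ᵐ y ∂μ.toJordanDecomposition.posPart, y ∈ closedBall (0 : En n) R :=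
    mem_ae_iff.2 hs.1
  have hν' : ∀ᵐ y ∂μ.toJordanDecomposition.negPart, y ∈ closedBall (0 : En n) R :=
    mem_ae_iff.2 hs.2
  have hf' : ∀ x, R < ‖x‖ → f x = (omegaN n : ℂ)⁻¹ *
      (∫ y, kern n P (x, y) ∂μ.toJordanDecomposition.posPart -
        ∫ y, kern n P (x, y) ∂μ.toJordanDecomposition.negPart) := by
    intro x hx
    rw [hf x, qP, sInt, mul_left_comm, mul_sub, ← integral_const_mul, ← integral_const_mul]
    congr 2
    · refine integral_congr_ae ?_
      filter_upwards [hν] with y hy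
      exact qP_integrand hn P (lt_of_le_of_lt (by simpa using hy) hx)
    · refine integral_congr_ae ?_
      filter_upwards [hν'] with y hy
      exact qP_integrand hn P (lt_of_le_of_lt (by simpa using hy) hx)
  intro x hx
  have hz : ∀ y, y ∈ closedBall (0 : En n) R → (plap n)^[NP] (kern n P) (x, y) = 0 := by
    intro y hy
    have hlt : ‖y‖ < ‖x‖ := lt_of_le_of_lt (by simpa using hy) hx
    rw [plap_iter]
    exact kern_polyharm hn hC (UU_ne (p := (x, y)) hlt)
  rw [Ker_iter (kern_contDiffOn n P) _ hν hν' hf' NP x hx,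
    integral_eq_zero_of_ae (hν.mono hz), integral_eq_zero_of_ae (hν'.mono hz)]
  simp
end
end

section
/- Let μ be a finite non-negative measure on ℝⁿ (n ≥ 2) with support in the closed ball of radius R and let P be a polynomial on ℝⁿ. Then the support of μ is contained in the zero set P^{−1}{0} if and only if P(ζθ) μ̂(ζ,θ) = Q_P(ζ,θ) for all θ ∈ S^{n-1} and all ζ ∈ ℂ with |ζ| > R, where Q_P is the function of the second kind associated to P and μ. -/
open MeasureTheory Metric MvPolynomial

noncomputable section

theorem mt_restrict {n : ℕ} {R : ℝ} {μ : Measure (En n)}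
    (hμ : μ (closedBall (0 : En n) R)ᶜ = 0) : μ.restrict (closedBall (0 : En n) R) = μ :=
  Measure.restrict_eq_self_of_ae_mem (by rw [ae_iff]; exact hμ)

theorem mt_ae {n : ℕ} {R : ℝ} {μ : Measure (En n)}
    (hμ : μ (closedBall (0 : En n) R)ᶜ = 0) : ∀ᵐ x ∂μ, x ∈ closedBall (0 : En n) R := by
  rw [ae_iff]; exact hμ

theorem mt_int {n : ℕ} {R : ℝ} {μ : Measure (En n)} [IsFiniteMeasure μ]
    (hμ : μ (closedBall (0 : En n) R)ᶜ = 0) {E : Type*} [NormedAddCommGroup E] {g : En n → E}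
    (hg : ContinuousOn g (closedBall (0 : En n) R)) : Integrable g μ := by
  have h := hg.integrableOn_compact (μ := μ) (isCompact_closedBall _ _)
  rwa [IntegrableOn, mt_restrict hμ] at h

theorem mt_diff {n : ℕ} {R : ℝ} {μ : Measure (En n)} [IsFiniteMeasure μ]
    (hμ : μ (closedBall (0 : En n) R)ᶜ = 0) (F F' : ℝ → En n → ℝ) (δ : ℝ) (hδ : 0 < δ)
    (hF : ∀ s ∈ Set.Icc (-δ) δ, ContinuousOn (F s) (closedBall (0 : En n) R))
    (hF' : ContinuousOn (Function.uncurry F') (Set.Icc (-δ) δ ×ˢ closedBall (0 : En n) R))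
    (hd : ∀ s ∈ Set.Icc (-δ) δ, ∀ x ∈ closedBall (0 : En n) R,
      HasDerivAt (fun s => F s x) (F' s x) s)
    (h0 : ∀ s ∈ Set.Icc (-δ) δ, ∫ x, F s x ∂μ = 0) : ∫ x, F' 0 x ∂μ = 0 := by
  obtain ⟨C, hC⟩ := (isCompact_Icc.prod (isCompact_closedBall _ _)).exists_bound_of_continuousOn hF'
  have hs : Set.Icc (-δ) δ ∈ nhds (0 : ℝ) := Icc_mem_nhds (by linarith) hδ
  have h00 : (0 : ℝ) ∈ Set.Icc (-δ) δ := ⟨by linarith, hδ.le⟩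
  have hF'0 : ContinuousOn (F' 0) (closedBall (0 : En n) R) :=
    hF'.comp (f := fun x => ((0 : ℝ), x)) (by fun_prop) (fun x hx => ⟨h00, hx⟩)
  have key := (hasDerivAt_integral_of_dominated_loc_of_deriv_le (μ := μ) (F := F) (F' := F')
    (bound := fun _ => C) hs
    (by filter_upwards [hs] with s h using (mt_int hμ (hF s h)).aestronglyMeasurable)
    (mt_int hμ (hF 0 h00)) (mt_int hμ hF'0).aestronglyMeasurable
    (by filter_upwards [mt_ae hμ] with x hx s h using hC (s, x) ⟨h, hx⟩)
    (integrable_const _)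
    (by filter_upwards [mt_ae hμ] with x hx s h using hd s h x hx)).2
  have h2 : HasDerivAt (fun s => ∫ x, F s x ∂μ) 0 0 := by
    apply (hasDerivAt_const (0 : ℝ) (0 : ℝ)).congr_of_eventuallyEq
    filter_upwards [hs] with s h using h0 s h
  exact key.unique h2

theorem mt_nsq {n : ℕ} (y x : En n) (i : Fin n) (s : ℝ) :
    HasDerivAt (fun s : ℝ => ‖y + s • EuclideanSpace.single i (1 : ℝ) - x‖ ^ 2)
      (2 * (y + s • EuclideanSpace.single i (1 : ℝ) - x) i) s := by
  have h : HasDerivAt (fun s : ℝ => y + s • EuclideanSpace.single i (1 : ℝ) - x)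
      (EuclideanSpace.single i (1 : ℝ)) s := by
    simpa using (((hasDerivAt_id s).smul_const (EuclideanSpace.single i (1 : ℝ))).const_add
      y).sub_const x
  have := h.norm_sq
  simpa [EuclideanSpace.inner_single_right] using this

theorem mt_ne {n : ℕ} {R : ℝ} {y x : En n} (hy : R < ‖y‖) (hx : x ∈ closedBall (0 : En n) R) :
    0 < ‖y - x‖ ^ 2 := by
  have : ‖x‖ ≤ R := by simpa using hx
  have h : y - x ≠ 0 := by
    intro h
    rw [sub_eq_zero] at h
    subst h
    linarith
  positivity

theorem mt_shift {n : ℕ} {R : ℝ} {y : En n} (hy : R < ‖y‖) (i : Fin n) {s : ℝ}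
    (hs : s ∈ Set.Icc (-((‖y‖ - R) / 2)) ((‖y‖ - R) / 2)) :
    R < ‖y + s • EuclideanSpace.single i (1 : ℝ)‖ := by
  have h1 : ‖s • EuclideanSpace.single i (1 : ℝ)‖ = |s| := by simp [norm_smul]
  have h2 := norm_sub_le (y + s • EuclideanSpace.single i (1 : ℝ))
    (s • EuclideanSpace.single i (1 : ℝ))
  rw [add_sub_cancel_right, h1] at h2
  have := abs_le.2 hs
  linarith

theorem mt_lap {n : ℕ} {R : ℝ} {μ : Measure (En n)} [IsFiniteMeasure μ]
    (hμ : μ (closedBall (0 : En n) R)ᶜ = 0) (f : En n → ℝ) (hf : Continuous f) (p : ℝ) (hp : p ≠ 0)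
    (h : ∀ y : En n, R < ‖y‖ → ∫ x, f x * (‖y - x‖ ^ 2) ^ p ∂μ = 0) (y : En n) (hy : R < ‖y‖) :
    (n + 2 * (p - 1)) * ∫ x, f x * (‖y - x‖ ^ 2) ^ (p - 1) ∂μ = 0 := by
  have hpos : ∀ y : En n, R < ‖y‖ → 0 < (‖y‖ - R) / 2 := fun y hy => by linarith
  have hc : ∀ (q : ℝ) (y : En n), R < ‖y‖ → ContinuousOn (fun x : En n => (‖y - x‖ ^ 2) ^ q)
      (closedBall (0 : En n) R) := fun q y hy =>
    ContinuousOn.rpow_const (by fun_prop) (fun x hx => Or.inl (mt_ne hy hx).ne')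
  have hcu : ∀ (q : ℝ) (y : En n) (i : Fin n), R < ‖y‖ → ContinuousOn
      (fun z : ℝ × En n => (‖y + z.1 • EuclideanSpace.single i (1 : ℝ) - z.2‖ ^ 2) ^ q)
      (Set.Icc (-((‖y‖ - R) / 2)) ((‖y‖ - R) / 2) ×ˢ closedBall (0 : En n) R) := fun q y i hy =>
    ContinuousOn.rpow_const (by fun_prop)
      (fun z hz => Or.inl (mt_ne (mt_shift hy i hz.1) hz.2).ne')
  have h1 : ∀ i : Fin n, ∀ y : En n, R < ‖y‖ →
      ∫ x, f x * ((2 * (y - x) i) * p * (‖y - x‖ ^ 2) ^ (p - 1)) ∂μ = 0 := by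
    intro i y hy
    have := mt_diff hμ
      (fun s x => f x * (‖y + s • EuclideanSpace.single i (1 : ℝ) - x‖ ^ 2) ^ p)
      (fun s x => f x * ((2 * (y + s • EuclideanSpace.single i (1 : ℝ) - x) i) * p *
        (‖y + s • EuclideanSpace.single i (1 : ℝ) - x‖ ^ 2) ^ (p - 1))) _ (hpos y hy)
      (fun s hs => hf.continuousOn.mul (hc p _ (mt_shift hy i hs)))
      (ContinuousOn.mul (by fun_prop) (ContinuousOn.mul (by fun_prop) (hcu _ y i hy)))
      (fun s hs x hx => ((mt_nsq y x i s).rpow_const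
        (Or.inl (mt_ne (mt_shift hy i hs) hx).ne')).const_mul (f x))
      (fun s hs => h _ (mt_shift hy i hs))
    simpa using this
  have h2 : ∀ i : Fin n, 
      ∫ x, f x * (2 * p * (‖y - x‖ ^ 2) ^ (p - 1) + 2 * (y - x) i * p *
        (2 * (y - x) i * (p - 1) * (‖y - x‖ ^ 2) ^ (p - 1 - 1))) ∂μ = 0 := by
    intro i
    have := mt_diff hμ
      (fun s x => f x * ((2 * (y + s • EuclideanSpace.single i (1 : ℝ) - x) i) * p *
        (‖y + s • EuclideanSpace.single i (1 : ℝ) - x‖ ^ 2) ^ (p - 1)))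
      (fun s x => f x * (2 * p * (‖y + s • EuclideanSpace.single i (1 : ℝ) - x‖ ^ 2) ^ (p - 1) +
        2 * (y + s • EuclideanSpace.single i (1 : ℝ) - x) i * p *
        (2 * (y + s • EuclideanSpace.single i (1 : ℝ) - x) i * (p - 1) *
        (‖y + s • EuclideanSpace.single i (1 : ℝ) - x‖ ^ 2) ^ (p - 1 - 1)))) _ (hpos y hy)
      (fun s hs => hf.continuousOn.mul (ContinuousOn.mul (by fun_prop)
        (hc _ _ (mt_shift hy i hs))))
      (ContinuousOn.mul (by fun_prop) (ContinuousOn.add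
        (ContinuousOn.mul (by fun_prop) (hcu _ y i hy))
        (ContinuousOn.mul (by fun_prop) (ContinuousOn.mul (by fun_prop) (hcu _ y i hy)))))
      (fun s hs x hx => by
        have e1 := (mt_nsq y x i s).rpow_const (p := p - 1)
          (Or.inl (mt_ne (mt_shift hy i hs) hx).ne')
        have e2 : HasDerivAt (fun s : ℝ =>
            2 * (y + s • EuclideanSpace.single i (1 : ℝ) - x) i * p) (2 * p) s := by
          have : HasDerivAt (fun s : ℝ => 2 * (y i + s - x i) * p) (2 * 1 * p) s :=
            ((((hasDerivAt_id s).const_add (y i)).sub_const (x i)).const_mul 2).mul_const p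
          simpa using this
        exact (e2.mul e1).const_mul (f x))
      (fun s hs => h1 i _ (mt_shift hy i hs))
    simpa using this
  have h3 : ∑ i : Fin n, ∫ x, f x * (2 * p * (‖y - x‖ ^ 2) ^ (p - 1) + 2 * (y - x) i * p *
        (2 * (y - x) i * (p - 1) * (‖y - x‖ ^ 2) ^ (p - 1 - 1))) ∂μ = 0 :=
    Finset.sum_eq_zero fun i _ => h2 i
  rw [← integral_finsetSum] at h3
  · have h4 : (2 * p) * ((n + 2 * (p - 1)) * ∫ x, f x * (‖y - x‖ ^ 2) ^ (p - 1) ∂μ) = 0 := by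
      rw [← integral_const_mul, ← integral_const_mul, ← h3]
      apply integral_congr_ae
      filter_upwards [mt_ae hμ] with x hx
      have hA := mt_ne hy hx
      have e : (‖y - x‖ ^ 2) ^ (p - 1) = (‖y - x‖ ^ 2) ^ (p - 1 - 1) * ‖y - x‖ ^ 2 := by
        rw [← Real.rpow_add_one hA.ne', sub_add_cancel]
      have e2 : ‖y - x‖ ^ 2 = ∑ i, (y - x) i ^ 2 := by
        rw [EuclideanSpace.norm_sq_eq]; simp
      have e3 : ∀ i : Fin n, f x * (2 * p * (‖y - x‖ ^ 2) ^ (p - 1) + 2 * (y - x) i * p *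
        (2 * (y - x) i * (p - 1) * (‖y - x‖ ^ 2) ^ (p - 1 - 1))) =
          f x * (2 * p * (‖y - x‖ ^ 2) ^ (p - 1)) +
          f x * 4 * p * (p - 1) * (‖y - x‖ ^ 2) ^ (p - 1 - 1) * (y - x) i ^ 2 := fun i => by ring
      simp_rw [e3]
      rw [Finset.sum_add_distrib, Finset.sum_const, ← Finset.mul_sum, ← e2, e]
      simp
      ring
    simpa [hp] using h4
  · intro i _
    refine mt_int hμ (hf.continuousOn.mul (ContinuousOn.add
        (ContinuousOn.mul (by fun_prop) (hc _ y hy))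
        (ContinuousOn.mul (by fun_prop) (ContinuousOn.mul (by fun_prop) (hc _ y hy)))))

theorem mt_all {n : ℕ} (hn : 2 ≤ n) {R : ℝ} {μ : Measure (En n)} [IsFiniteMeasure μ]
    (hμ : μ (closedBall (0 : En n) R)ᶜ = 0) (f : En n → ℝ) (hf : Continuous f)
    (h : ∀ y : En n, R < ‖y‖ → ∫ x, f x * (‖y - x‖ ^ 2) ^ (-((n : ℝ) / 2)) ∂μ = 0) (m : ℕ) :
    ∀ y : En n, R < ‖y‖ → ∫ x, f x * (‖y - x‖ ^ 2) ^ (-((n : ℝ) / 2) - m) ∂μ = 0 := by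
  induction m with
  | zero => simpa using h
  | succ m ih =>
    intro y hy
    have hn' : (2 : ℝ) ≤ n := by exact_mod_cast hn
    have hm : (0 : ℝ) ≤ m := by positivity
    have := mt_lap hμ f hf _ (by intro h; linarith) ih y hy
    rcases mul_eq_zero.1 this with h1 | h1
    · linarith
    · rw [← h1]
      congr 1
      ext x
      congr 2
      push_cast
      ring

theorem mt_cont {n : ℕ} (hn : 2 ≤ n) {R : ℝ} (hR : 0 ≤ R) {μ : Measure (En n)}
    [IsFiniteMeasure μ]
    (hμ : μ (closedBall (0 : En n) R)ᶜ = 0) (f : En n → ℝ) (hf : Continuous f)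
    (h : ∀ y : En n, R < ‖y‖ → ∫ x, f x * (‖y - x‖ ^ 2) ^ (-((n : ℝ) / 2)) ∂μ = 0)
    (y : En n) (hy : R < ‖y‖) (g : ℝ → ℝ) (hg : Continuous g) :
    ∫ x, f x * g (‖y - x‖ ^ 2) ∂μ = 0 := by
  set q : ℝ := -((n : ℝ) / 2) with hq
  have hA : ∀ x ∈ closedBall (0 : En n) R, 0 < ‖y - x‖ ^ 2 := fun x hx => mt_ne hy hx
  have hc : ∀ q : ℝ, ContinuousOn (fun x : En n => (‖y - x‖ ^ 2) ^ q)
      (closedBall (0 : En n) R) := fun q =>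
    ContinuousOn.rpow_const (by fun_prop) (fun x hx => Or.inl (mt_ne hy hx).ne')
  have hci : ContinuousOn (fun x : En n => (‖y - x‖ ^ 2)⁻¹) (closedBall (0 : En n) R) :=
    ContinuousOn.inv₀ (by fun_prop) (fun x hx => (mt_ne hy hx).ne')
  set a : ℝ := ((‖y‖ + R) ^ 2)⁻¹
  set b : ℝ := ((‖y‖ - R) ^ 2)⁻¹
  have ha : 0 < a := by
    have : 0 < ‖y‖ + R := by linarith
    positivity
  have hab : ∀ x ∈ closedBall (0 : En n) R, (‖y - x‖ ^ 2)⁻¹ ∈ Set.Icc a b := by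
    intro x hx
    have h1 : ‖x‖ ≤ R := by simpa using hx
    have h2 := norm_sub_le y x
    have h3 := norm_sub_norm_le y x
    have h4 : 0 < ‖y‖ - R := by linarith
    constructor
    · exact inv_anti₀ (hA x hx) (by gcongr; linarith)
    · exact inv_anti₀ (by positivity) (by gcongr; linarith)
  have hw : ContinuousOn (fun x => f x * (‖y - x‖ ^ 2) ^ q) (closedBall (0 : En n) R) :=
    hf.continuousOn.mul (hc q)
  have hpoly : ∀ p : Polynomial ℝ,
      ∫ x, f x * (‖y - x‖ ^ 2) ^ q * p.eval ((‖y - x‖ ^ 2)⁻¹) ∂μ = 0 := by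
    intro p
    have e : ∀ᵐ x ∂μ, f x * (‖y - x‖ ^ 2) ^ q * p.eval ((‖y - x‖ ^ 2)⁻¹) =
        ∑ m ∈ Finset.range (p.natDegree + 1),
          p.coeff m * (f x * (‖y - x‖ ^ 2) ^ (q - m)) := by
      filter_upwards [mt_ae hμ] with x hx
      rw [Polynomial.eval_eq_sum_range, Finset.mul_sum]
      refine Finset.sum_congr rfl fun m _ => ?_
      rw [Real.rpow_sub_natCast (hA x hx).ne', inv_pow]
      ring
    rw [integral_congr_ae e, integral_finsetSum]
    · refine Finset.sum_eq_zero fun m _ => ?_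
      rw [integral_const_mul, mt_all hn hμ f hf h m y hy, mul_zero]
    · intro m _
      exact (mt_int hμ (hf.continuousOn.mul (hc _))).const_mul _
  have hJ : ∫ x, f x * g (‖y - x‖ ^ 2) ∂μ =
      ∫ x, f x * (‖y - x‖ ^ 2) ^ q *
        (g (((‖y - x‖ ^ 2)⁻¹)⁻¹) * ((‖y - x‖ ^ 2)⁻¹) ^ q) ∂μ := by
    apply integral_congr_ae
    filter_upwards [mt_ae hμ] with x hx
    have : (‖y - x‖ ^ 2) ^ q * ((‖y - x‖ ^ 2)⁻¹) ^ q = 1 := by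
      rw [← Real.mul_rpow (hA x hx).le (inv_nonneg.2 (hA x hx).le),
        mul_inv_cancel₀ (hA x hx).ne', Real.one_rpow]
    rw [inv_inv]
    linear_combination (-(f x * g (‖y - x‖ ^ 2))) * this
  have hG : ContinuousOn (fun t : ℝ => g t⁻¹ * t ^ q) (Set.Icc a b) := by
    refine ContinuousOn.mul (hg.comp_continuousOn ?_) ?_
    · exact continuousOn_inv₀.mono fun t ht => (ha.trans_le ht.1).ne'
    · exact continuousOn_id.rpow_const fun t ht => Or.inl (ha.trans_le ht.1).ne'
  have hb : ∀ ε > 0, |∫ x, f x * g (‖y - x‖ ^ 2) ∂μ| ≤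
      ε * ∫ x, |f x * (‖y - x‖ ^ 2) ^ q| ∂μ := by
    intro ε hε
    obtain ⟨p, hp⟩ := exists_polynomial_near_of_continuousOn a b _ hG ε hε
    have e : ∫ x, f x * g (‖y - x‖ ^ 2) ∂μ = ∫ x, (f x * (‖y - x‖ ^ 2) ^ q *
        (g (((‖y - x‖ ^ 2)⁻¹)⁻¹) * ((‖y - x‖ ^ 2)⁻¹) ^ q) -
        f x * (‖y - x‖ ^ 2) ^ q * p.eval ((‖y - x‖ ^ 2)⁻¹)) ∂μ := by
      rw [integral_sub, hpoly p, sub_zero, hJ]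
      · exact mt_int hμ (hw.mul (hG.comp hci hab))
      · exact mt_int hμ (hw.mul (p.continuous.comp_continuousOn hci))
    rw [e, ← Real.norm_eq_abs, ← integral_const_mul]
    refine norm_integral_le_of_norm_le ((mt_int hμ hw).abs.const_mul ε) ?_
    filter_upwards [mt_ae hμ] with x hx
    rw [← mul_sub, norm_mul, Real.norm_eq_abs, Real.norm_eq_abs, mul_comm ε]
    have := (hp _ (hab x hx)).le
    rw [abs_sub_comm] at this
    gcongr
  by_contra hne
  have hI : 0 ≤ ∫ x, |f x * (‖y - x‖ ^ 2) ^ q| ∂μ := integral_nonneg fun x => abs_nonneg _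
  set J := ∫ x, f x * g (‖y - x‖ ^ 2) ∂μ
  set I := ∫ x, |f x * (‖y - x‖ ^ 2) ^ q| ∂μ
  have hJ0 : 0 < |J| := abs_pos.2 hne
  have h1 := hb (|J| / (I + 1)) (by positivity)
  have h2 : |J| / (I + 1) * I < |J| := by
    rw [div_mul_eq_mul_div, div_lt_iff₀ (by positivity)]
    nlinarith
  linarith

theorem mt_exp {n : ℕ} (hn : 2 ≤ n) {R : ℝ} (hR : 0 ≤ R) {μ : Measure (En n)}
    [IsFiniteMeasure μ]
    (hμ : μ (closedBall (0 : En n) R)ᶜ = 0) (f : En n → ℝ) (hf : Continuous f)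
    (h : ∀ y : En n, R < ‖y‖ → ∫ x, f x * (‖y - x‖ ^ 2) ^ (-((n : ℝ) / 2)) ∂μ = 0)
    (y : En n) (hy : R < ‖y‖) (c d : ℝ) :
    ∫ x, (f x : ℂ) * Complex.exp (((c * (‖y - x‖ ^ 2 - d) : ℝ) : ℂ) * Complex.I) ∂μ = 0 := by
  have h1 := mt_cont hn hR hμ f hf h y hy (fun u => Real.cos (c * (u - d))) (by fun_prop)
  have h2 := mt_cont hn hR hμ f hf h y hy (fun u => Real.sin (c * (u - d))) (by fun_prop)
  have e : ∀ x : En n, (f x : ℂ) *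
      Complex.exp (((c * (‖y - x‖ ^ 2 - d) : ℝ) : ℂ) * Complex.I) =
      ((f x * Real.cos (c * (‖y - x‖ ^ 2 - d)) : ℝ) : ℂ) +
      ((f x * Real.sin (c * (‖y - x‖ ^ 2 - d)) : ℝ) : ℂ) * Complex.I := by
    intro x
    rw [Complex.exp_mul_I, ← Complex.ofReal_cos, ← Complex.ofReal_sin]
    push_cast
    ring
  simp_rw [e]
  rw [integral_add, integral_mul_const, integral_complex_ofReal, integral_complex_ofReal]
  · beta_reduce at h1 h2
    rw [h1, h2]; simp
  · exact mt_int hμ (Continuous.continuousOn (by fun_prop))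
  · exact mt_int hμ (Continuous.continuousOn (by fun_prop))

theorem mt_char {n : ℕ} (hn : 2 ≤ n) {R : ℝ} (hR : 0 ≤ R) {μ : Measure (En n)}
    [IsFiniteMeasure μ]
    (hμ : μ (closedBall (0 : En n) R)ᶜ = 0) (f : En n → ℝ) (hf : Continuous f)
    (h : ∀ y : En n, R < ‖y‖ → ∫ x, f x * (‖y - x‖ ^ 2) ^ (-((n : ℝ) / 2)) ∂μ = 0)
    (t : En n) :
    ∫ x, (f x : ℂ) * Complex.exp (((inner ℝ x t : ℝ) : ℂ) * Complex.I) ∂μ = 0 := by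
  obtain ⟨v, hv, hvt⟩ : ∃ v : En n, R < ‖v‖ ∧ inner ℝ v t ≤ 0 := by
    set v : En n := EuclideanSpace.single (⟨0, by omega⟩ : Fin n) (R + 1) with hvdef
    have hv : R < ‖v‖ := by
      rw [hvdef, EuclideanSpace.norm_single, Real.norm_eq_abs]
      have := le_abs_self (R + 1)
      linarith
    rcases le_total (inner ℝ v t) 0 with h0 | h0
    · exact ⟨v, hv, h0⟩
    · exact ⟨-v, by rwa [norm_neg], by rw [inner_neg_left]; linarith⟩
  have hy : ∀ N : ℕ, R < ‖v - ((N : ℝ) + 1) • t‖ := by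
    intro N
    have : ‖v‖ ^ 2 ≤ ‖v - ((N : ℝ) + 1) • t‖ ^ 2 := by
      rw [norm_sub_sq_real, inner_smul_right]
      have : ((N : ℝ) + 1) * inner ℝ v t ≤ 0 :=
        mul_nonpos_of_nonneg_of_nonpos (by positivity) hvt
      have := sq_nonneg ‖((N : ℝ) + 1) • t‖
      linarith
    have := (sq_le_sq₀ (norm_nonneg _) (norm_nonneg _)).1 this
    linarith
  have key : Filter.Tendsto (fun N : ℕ => ∫ x, (f x : ℂ) * Complex.exp
      ((((1 / ((N : ℝ) + 1) / 2) * (‖v - ((N : ℝ) + 1) • t - x‖ ^ 2 -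
        ‖v - ((N : ℝ) + 1) • t‖ ^ 2) : ℝ) : ℂ) * Complex.I) ∂μ) Filter.atTop
      (nhds (∫ x, (f x : ℂ) * Complex.exp (((inner ℝ x t : ℝ) : ℂ) * Complex.I) ∂μ)) := by
    refine tendsto_integral_of_dominated_convergence (fun x => |f x|) ?_ ?_ ?_ ?_
    · intro N
      exact (mt_int hμ (Continuous.continuousOn (by fun_prop))).aestronglyMeasurable
    · exact mt_int hμ hf.abs.continuousOn
    · intro N
      refine Filter.Eventually.of_forall fun x => ?_
      rw [norm_mul, Complex.norm_exp_ofReal_mul_I, mul_one, Complex.norm_real, Real.norm_eq_abs]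
    · refine Filter.Eventually.of_forall fun x => ?_
      have e : ∀ N : ℕ, (1 / ((N : ℝ) + 1) / 2) * (‖v - ((N : ℝ) + 1) • t - x‖ ^ 2 -
        ‖v - ((N : ℝ) + 1) • t‖ ^ 2) = inner ℝ x t +
          1 / ((N : ℝ) + 1) * (‖x‖ ^ 2 / 2 - inner ℝ v x) := by
        intro N
        rw [norm_sub_sq_real, inner_sub_left, inner_smul_left, real_inner_comm x t]
        have : (N : ℝ) + 1 ≠ 0 := by positivity
        simp
        field_simp
        ring
      simp_rw [e]
      have hl : Filter.Tendsto (fun N : ℕ => inner ℝ x t +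
          1 / ((N : ℝ) + 1) * (‖x‖ ^ 2 / 2 - inner ℝ v x)) Filter.atTop
          (nhds (inner ℝ x t)) := by
        simpa using (tendsto_one_div_add_atTop_nhds_zero_nat (𝕜 := ℝ)).mul_const
          (‖x‖ ^ 2 / 2 - inner ℝ v x) |>.const_add (inner ℝ x t)
      have hcont : Continuous (fun r : ℝ => (f x : ℂ) * Complex.exp ((r : ℂ) * Complex.I)) := by
        fun_prop
      exact (hcont.tendsto _).comp hl
  have h0 : ∀ N : ℕ, ∫ x, (f x : ℂ) * Complex.exp
      ((((1 / ((N : ℝ) + 1) / 2) * (‖v - ((N : ℝ) + 1) • t - x‖ ^ 2 -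
        ‖v - ((N : ℝ) + 1) • t‖ ^ 2) : ℝ) : ℂ) * Complex.I) ∂μ = 0 := fun N =>
    mt_exp hn hR hμ f hf h _ (hy N) _ _
  simp_rw [h0] at key
  exact (tendsto_nhds_unique key tendsto_const_nhds)

theorem mt_zero {n : ℕ} (hn : 2 ≤ n) {R : ℝ} (hR : 0 ≤ R) {μ : Measure (En n)}
    [IsFiniteMeasure μ]
    (hμ : μ (closedBall (0 : En n) R)ᶜ = 0) (f : En n → ℝ) (hf : Continuous f)
    (h : ∀ y : En n, R < ‖y‖ → ∫ x, f x * (‖y - x‖ ^ 2) ^ (-((n : ℝ) / 2)) ∂μ = 0) :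
    ∀ᵐ x ∂μ, f x = 0 := by
  have hint : Integrable f μ := mt_int hμ hf.continuousOn
  have hm1 : Measurable fun x => ENNReal.ofReal (f x) := hf.measurable.ennreal_ofReal
  have hm2 : Measurable fun x => ENNReal.ofReal (-f x) := hf.neg.measurable.ennreal_ofReal
  haveI : IsFiniteMeasure (μ.withDensity fun x => ENNReal.ofReal (f x)) :=
    isFiniteMeasure_withDensity_ofReal hint.2
  haveI : IsFiniteMeasure (μ.withDensity fun x => ENNReal.ofReal (-f x)) :=
    isFiniteMeasure_withDensity_ofReal hint.neg.2
  have heq : (μ.withDensity fun x => ENNReal.ofReal (f x)) =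
      μ.withDensity fun x => ENNReal.ofReal (-f x) := by
    apply Measure.ext_of_charFun
    ext t
    rw [charFun_apply, charFun_apply,
      integral_withDensity_eq_integral_toReal_smul hm1 (by simp),
      integral_withDensity_eq_integral_toReal_smul hm2 (by simp), ← sub_eq_zero,
      ← integral_sub]
    · rw [← mt_char hn hR hμ f hf h t]
      congr 1
      ext x
      rw [← sub_smul, ENNReal.toReal_ofReal', ENNReal.toReal_ofReal', Complex.real_smul]
      congr 2
      rcases le_total 0 (f x) with h0 | h0
      · rw [max_eq_left h0, max_eq_right (by linarith)]; simp
      · rw [max_eq_right h0, max_eq_left (by linarith)]; simp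
    · simp_rw [ENNReal.toReal_ofReal']
      exact mt_int hμ (Continuous.continuousOn (by fun_prop))
    · simp_rw [ENNReal.toReal_ofReal']
      exact mt_int hμ (Continuous.continuousOn (by fun_prop))
  have h2 := (withDensity_eq_iff hm1.aemeasurable hm2.aemeasurable
    (by
      have := measure_ne_top (μ.withDensity fun x => ENNReal.ofReal (f x)) Set.univ
      rwa [withDensity_apply _ MeasurableSet.univ, Measure.restrict_univ] at this)).1 heq
  filter_upwards [h2] with x hx
  have hx' := congrArg ENNReal.toReal hx
  simp only [ENNReal.toReal_ofReal'] at hx'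
  rcases le_total 0 (f x) with h0 | h0
  · rw [max_eq_left h0, max_eq_right (by linarith)] at hx'; exact hx'
  · rw [max_eq_right h0, max_eq_left (by linarith)] at hx'; linarith

theorem mt_kernel {n : ℕ} {y : En n} (hy : 0 < ‖y‖) (x : En n) :
    ((‖y‖ : ℝ) : ℂ) ^ (n - 1) / rPow n ((‖y‖ : ℝ) : ℂ) ((‖y‖⁻¹ : ℝ) • y) x =
      ((‖y‖ ^ (n - 1) * (‖y - x‖ ^ 2) ^ (-((n : ℝ) / 2)) : ℝ) : ℂ) := by
  have e1 : rPow n ((‖y‖ : ℝ) : ℂ) ((‖y‖⁻¹ : ℝ) • y) x =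
      (((‖y - x‖ ^ 2) ^ ((n : ℝ) / 2) : ℝ) : ℂ) := by
    have e2 : (1 - 2 * ((inner ℝ ((‖y‖⁻¹ : ℝ) • y) x : ℝ) : ℂ) / ((‖y‖ : ℝ) : ℂ) +
        ((‖x‖ : ℂ)) ^ 2 / ((‖y‖ : ℝ) : ℂ) ^ 2) = ((‖y - x‖ ^ 2 / ‖y‖ ^ 2 : ℝ) : ℂ) := by
      norm_cast
      rw [norm_sub_sq_real, real_inner_smul_left]
      field_simp
    have e3 : ((n : ℂ) / 2) = (((n : ℝ) / 2 : ℝ) : ℂ) := by push_cast; rfl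
    rw [rPow, e2, e3, ← Complex.ofReal_cpow (by positivity)]
    norm_cast
    rw [Real.div_rpow (by positivity) (by positivity)]
    have : (‖y‖ ^ 2) ^ ((n : ℝ) / 2) = ‖y‖ ^ n := by
      rw [← Real.rpow_natCast, ← Real.rpow_mul hy.le, ← Real.rpow_natCast]
      congr 1
      push_cast
      ring
    rw [this]
    field_simp
  rw [e1, Real.rpow_neg (by positivity)]
  push_cast
  rw [div_eq_mul_inv]

theorem mt_omega {n : ℕ} (hn : 2 ≤ n) : (omegaN n : ℂ) ≠ 0 := by
  have : omegaN n ≠ 0 := by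
    rw [omegaN, sphereMeasure, Measure.toSphere_apply_univ, ENNReal.toReal_mul]
    refine mul_ne_zero ?_ ?_
    · simp; omega
    · exact (ENNReal.toReal_pos (measure_ball_pos _ _ one_pos).ne' measure_ball_lt_top.ne).ne'
  exact_mod_cast this

/-- A finite nonnegative measure `μ` supported in the closed
ball of radius `R` has support in `P⁻¹{0}` iff `P(ζθ) μ̂(ζ,θ) = Q_P(ζ,θ)` for
all `θ ∈ S^{n-1}` and `|ζ| > R`. -/
theorem support_in_zeroSet_iff_markov_eq_secondKind
    (n : ℕ) (hn : 2 ≤ n) (R : ℝ)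
    (μ : Measure (En n)) [IsFiniteMeasure μ]
    (hμ : μ (closedBall (0 : En n) R)ᶜ = 0)
    (P : MvPolynomial (Fin n) ℂ) :
    μ {x : En n | evalR P x ≠ 0} = 0 ↔
      ∀ θ : sphere (0 : En n) 1, ∀ ζ : ℂ, R < ‖ζ‖ →
        evalC P ζ (θ : En n) * markovM μ ζ (θ : En n) = qPM μ P ζ (θ : En n) := by
  constructor
  · intro h θ ζ _
    have hae : ∀ᵐ x ∂μ, evalR P x = 0 := by rw [ae_iff]; exact h
    rw [markovM, qPM, mul_left_comm, ← integral_const_mul]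
    congr 1
    apply integral_congr_ae
    filter_upwards [hae] with x hx
    rw [hx, sub_zero, mul_div_assoc]
  · intro h
    have hPc : Continuous fun x : En n => evalR P x := by
      unfold evalR
      exact (MvPolynomial.continuous_eval P).comp (by fun_prop)
    have hR' : 0 ≤ max R 0 := le_max_right _ _
    have hμ' : μ (closedBall (0 : En n) (max R 0))ᶜ = 0 :=
      measure_mono_null (Set.compl_subset_compl.2 (closedBall_subset_closedBall (le_max_left _ _)))
        hμ
    have key : ∀ y : En n, max R 0 < ‖y‖ →
        ∫ x, evalR P x * (((‖y - x‖ ^ 2) ^ (-((n : ℝ) / 2)) : ℝ) : ℂ) ∂μ = 0 := by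
      intro y hy
      have hy0 : 0 < ‖y‖ := lt_of_le_of_lt hR' hy
      have h1 := h ⟨(‖y‖⁻¹ : ℝ) • y, by simp [norm_smul, hy0.ne']⟩ ((‖y‖ : ℝ) : ℂ)
        (by simpa using lt_of_le_of_lt (le_max_left R 0) hy)
      have hk : ContinuousOn (fun x : En n => (((‖y - x‖ ^ 2) ^ (-((n : ℝ) / 2)) : ℝ) : ℂ))
          (closedBall (0 : En n) (max R 0)) :=
        Complex.continuous_ofReal.comp_continuousOn
          (ContinuousOn.rpow_const (by fun_prop) (fun x hx => Or.inl (mt_ne hy hx).ne'))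
      have i1 := mt_int hμ' hk
      have i2 := mt_int hμ' (hPc.continuousOn.mul hk)
      simp only [markovM, qPM] at h1
      rw [mul_left_comm] at h1
      have h2 := mul_left_cancel₀ (inv_ne_zero (mt_omega hn)) h1
      simp_rw [mul_div_assoc, mt_kernel hy0] at h2
      set C := evalC P ((‖y‖ : ℝ) : ℂ) ((‖y‖⁻¹ : ℝ) • y)
      have e : ∀ x : En n, (C - evalR P x) *
          ((‖y‖ ^ (n - 1) * (‖y - x‖ ^ 2) ^ (-((n : ℝ) / 2)) : ℝ) : ℂ) =
          C * ((‖y‖ ^ (n - 1) * (‖y - x‖ ^ 2) ^ (-((n : ℝ) / 2)) : ℝ) : ℂ) -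
          ((‖y‖ ^ (n - 1) : ℝ) : ℂ) *
            (evalR P x * (((‖y - x‖ ^ 2) ^ (-((n : ℝ) / 2)) : ℝ) : ℂ)) := by
        intro x; push_cast; ring
      simp_rw [e] at h2
      rw [integral_sub, integral_const_mul, integral_const_mul] at h2
      · have h3 : ((‖y‖ ^ (n - 1) : ℝ) : ℂ) *
            ∫ x, evalR P x * (((‖y - x‖ ^ 2) ^ (-((n : ℝ) / 2)) : ℝ) : ℂ) ∂μ = 0 := by
          linear_combination h2
        refine (mul_eq_zero.1 h3).resolve_left ?_
        exact_mod_cast (pow_pos hy0 _).ne'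
      · refine Integrable.const_mul ?_ _
        simp_rw [Complex.ofReal_mul]
        exact i1.const_mul _
      · exact i2.const_mul _
    have hint : ∀ y : En n, max R 0 < ‖y‖ → Integrable
        (fun x => evalR P x * (((‖y - x‖ ^ 2) ^ (-((n : ℝ) / 2)) : ℝ) : ℂ)) μ := fun y hy =>
      mt_int hμ' (hPc.continuousOn.mul (Complex.continuous_ofReal.comp_continuousOn
          (ContinuousOn.rpow_const (by fun_prop) (fun x hx => Or.inl (mt_ne hy hx).ne'))))
    have hre := mt_zero hn hR' hμ' (fun x => (evalR P x).re) (by fun_prop) (fun y hy => by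
      have := integral_re (hint y hy)
      simp only [RCLike.re_to_complex, key y hy, Complex.re_mul_ofReal] at this
      simpa using this)
    have him := mt_zero hn hR' hμ' (fun x => (evalR P x).im) (by fun_prop) (fun y hy => by
      have := integral_im (hint y hy)
      simp only [RCLike.im_to_complex, key y hy, Complex.im_mul_ofReal] at this
      simpa using this)
    have hae : ∀ᵐ x ∂μ, evalR P x = 0 := by
      filter_upwards [hre, him] with x h1 h2
      exact Complex.ext h1 h2
    rw [ae_iff] at hae
    exact hae
end
end

section
/- Let σ be a finite non-negative measure on ℝ with compact support, let δ₀ be the Dirac measure at 0 on ℝ, and let μ = σ ⊗ δ₀ on ℝ². Then the multivariate Markov transform of μ satisfies, for θ = e^{it} ∈ S¹ and |ζ| large, μ̂(ζ, e^{it}) = (1/ω₂) Σ_{l=0}^∞ (∫ x^l dσ(x)) (sin((l+1)t)/sin t) ζ^{−(l+1)}. Moreover, μ has support in an algebraic set, but μ̂ is a rational function of ζ (for θ fixed with t = π/2) if and only if σ has finite support. -/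
open MeasureTheory Metric MvPolynomial

noncomputable section

/-- The identification `ℝ × ℝ ≃ ℝ²` (as a Euclidean space). -/
def toE2 (p : ℝ × ℝ) : En 2 := (EuclideanSpace.equiv (Fin 2) ℝ).symm ![p.1, p.2]

lemma aux_integrable (σ : Measure ℝ) [IsFiniteMeasure σ] (R : ℝ)
    (hσ : ∀ᵐ x ∂σ, |x| ≤ R) (f : ℝ → ℂ) (hm : Measurable f) (C : ℝ)
    (hC : ∀ x, |x| ≤ R → ‖f x‖ ≤ C) : Integrable f σ := by
  refine Integrable.of_bound hm.aestronglyMeasurable C ?_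
  filter_upwards [hσ] with x hx using hC x hx

lemma aux_toE2_meas : Measurable (fun x : ℝ => toE2 (x, 0)) := by
  unfold toE2
  apply Continuous.measurable
  fun_prop

lemma aux_markov (σ : Measure ℝ) [IsFiniteMeasure σ] (ζ : ℂ) (t : ℝ) :
    markovM ((σ.prod (Measure.dirac (0 : ℝ))).map toE2) ζ (toE2 (Real.cos t, Real.sin t)) =
    (omegaN 2 : ℂ)⁻¹ * ∫ x : ℝ, ζ / (ζ ^ 2 * (1 - 2 * ((Real.cos t * x : ℝ) : ℂ) / ζ +
      (x : ℂ) ^ 2 / ζ ^ 2)) ∂σ := by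
  have hm : Measurable toE2 := by
    unfold toE2
    apply Continuous.measurable
    fun_prop
  rw [Measure.prod_dirac, Measure.map_map hm (by fun_prop)]
  unfold markovM
  rw [integral_map (hm.comp (by fun_prop)).aemeasurable]
  · congr 1
    apply integral_congr_ae
    filter_upwards with x
    have h1 : inner ℝ (toE2 (Real.cos t, Real.sin t)) (toE2 (x, 0)) = Real.cos t * x := by
      simp [toE2, PiLp.inner_apply, Fin.sum_univ_two, mul_comm]
    have h2 : ((‖toE2 (x, 0)‖ : ℝ) : ℂ) ^ 2 = (x : ℂ) ^ 2 := by
      norm_cast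
      simp [toE2, EuclideanSpace.norm_sq_eq, Fin.sum_univ_two]
    simp only [Function.comp, rPow, h1, h2]
    norm_num
  · apply Measurable.aestronglyMeasurable
    unfold rPow
    fun_prop

lemma aux_omega : omegaN 2 ≠ 0 := by
  unfold omegaN sphereMeasure
  have h := Measure.toSphere_apply_univ (volume : Measure (En 2))
  rw [h]
  have h1 : volume (ball (0 : En 2) 1) ≠ 0 := (measure_ball_pos _ _ one_pos).ne'
  have h2 : volume (ball (0 : En 2) 1) ≠ ⊤ := measure_ball_lt_top.ne
  rw [ENNReal.toReal_mul]
  refine mul_ne_zero ?_ (ENNReal.toReal_ne_zero.mpr ⟨h1, h2⟩)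
  simp

lemma aux_hasSum_congr {f g : ℕ → ℂ} {a b : ℂ} (h : HasSum g b) (h1 : ∀ l, f l = g l)
    (h2 : a = b) : HasSum f a := by
  rw [h2, funext h1]
  exact h

lemma aux_hasSum (t : ℝ) (ht : Real.sin t ≠ 0) (ζ : ℂ) (x : ℝ) (h : |x| < ‖ζ‖) :
    HasSum (fun l : ℕ => ((x ^ l : ℝ) : ℂ) *
          ((Real.sin ((l + 1) * t) / Real.sin t : ℝ) : ℂ) * ζ ^ (-(l : ℤ) - 1))
      (ζ / (ζ ^ 2 * (1 - 2 * ((Real.cos t * x : ℝ) : ℂ) / ζ + (x : ℂ) ^ 2 / ζ ^ 2))) := by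
  have hz : 0 < ‖ζ‖ := (abs_nonneg x).trans_lt h
  have hζ : ζ ≠ 0 := norm_pos_iff.mp hz
  set e : ℂ := Complex.exp (t * Complex.I) with he
  set eb : ℂ := Complex.exp (-t * Complex.I) with heb
  have hee : e * eb = 1 := by rw [he, heb, ← Complex.exp_add]; simp
  have hne : ‖e‖ = 1 := Complex.norm_exp_ofReal_mul_I t
  have hneb : ‖eb‖ = 1 := by
    have := Complex.norm_exp_ofReal_mul_I (-t)
    rw [heb]; push_cast at this; exact this
  have hs : (Real.sin t : ℂ) = (eb - e) * Complex.I / 2 := by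
    rw [Complex.ofReal_sin, Complex.sin]
  have hc : (Real.cos t : ℂ) = (e + eb) / 2 := by
    rw [Complex.ofReal_cos, Complex.cos]
  have hsl : ∀ l : ℕ, (Real.sin ((l + 1) * t) : ℂ) = (eb ^ (l+1) - e ^ (l+1)) * Complex.I / 2 := by
    intro l
    rw [Complex.ofReal_sin, Complex.sin, he, heb, ← Complex.exp_nat_mul, ← Complex.exp_nat_mul]
    push_cast
    ring_nf
  have hs0 : (eb - e) ≠ 0 := by
    intro h0
    apply ht
    have : (Real.sin t : ℂ) = 0 := by rw [hs, h0]; simp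
    exact_mod_cast this
  have hlt : ∀ u : ℂ, ‖u‖ = 1 → ‖u * x / ζ‖ < 1 := by
    intro u hu
    rw [norm_div, norm_mul, hu, one_mul, div_lt_one hz]
    simpa using h
  have hne1 : ∀ u : ℂ, ‖u‖ = 1 → ζ - u * x ≠ 0 := by
    intro u hu h0
    have := hlt u hu
    rw [← sub_eq_zero.mp h0, div_self hζ] at this
    simp at this
  have g1 := (hasSum_geometric_of_norm_lt_one (hlt e hne)).mul_left (e / ((eb - e) * ζ))
  have g2 := (hasSum_geometric_of_norm_lt_one (hlt eb hneb)).mul_left (eb / ((eb - e) * ζ))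
  have g := g2.sub g1
  have a1 := hne1 e hne
  have a2 := hne1 eb hneb
  refine aux_hasSum_congr g ?_ ?_
  · intro l
    have : ζ ^ (-(l : ℤ) - 1) = (ζ ^ (l+1))⁻¹ := by
      rw [← zpow_natCast, ← zpow_neg]; congr 1; push_cast; ring
    rw [this, Complex.ofReal_div, hsl, hs]
    have hI := Complex.I_ne_zero
    push_cast
    rw [div_pow, div_pow, mul_pow, mul_pow]
    field_simp
    ring
  · have k : ζ ^ 2 * (1 - 2 * ((Real.cos t * x : ℝ) : ℂ) / ζ + (x : ℂ) ^ 2 / ζ ^ 2) =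
      (ζ - e * x) * (ζ - eb * x) := by
      rw [Complex.ofReal_mul, hc]
      field_simp
      linear_combination (-x^2 : ℂ) * hee
    have b1 : (1 - e * x / ζ)⁻¹ = ζ / (ζ - e * x) := by field_simp
    have b2 : (1 - eb * x / ζ)⁻¹ = ζ / (ζ - eb * x) := by field_simp
    rw [k, b1, b2]
    have hAB : eb * (ζ - e * x) - e * (ζ - eb * x) = (eb - e) * ζ := by ring
    generalize ζ - e * x = A at *
    generalize ζ - eb * x = B at *
    generalize eb - e = S at *
    have : ζ = (eb * A - e * B) / S := by rw [hAB]; field_simp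
    have h3 : ζ / (A * B) = (eb * A - e * B) / S / (A * B) := by rw [← this]
    rw [h3]
    field_simp

lemma aux_part1 (σ : Measure ℝ) [IsFiniteMeasure σ] (R : ℝ) (hR : 0 < R)
    (hσ : ∀ᵐ x ∂σ, |x| ≤ R) (t : ℝ) (ht : Real.sin t ≠ 0) (ζ : ℂ) (h : R < ‖ζ‖) :
    HasSum (fun l : ℕ => ((∫ x : ℝ, x ^ l ∂σ : ℝ) : ℂ) *
          ((Real.sin ((l + 1) * t) / Real.sin t : ℝ) : ℂ) * ζ ^ (-(l : ℤ) - 1))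
      (∫ x : ℝ, ζ / (ζ ^ 2 * (1 - 2 * ((Real.cos t * x : ℝ) : ℂ) / ζ + (x : ℂ) ^ 2 / ζ ^ 2)) ∂σ) := by
  have hz : 0 < ‖ζ‖ := hR.trans h
  have key := hasSum_integral_of_dominated_convergence (μ := σ)
    (F := fun (l : ℕ) (x : ℝ) => ((x ^ l : ℝ) : ℂ) *
          ((Real.sin ((l + 1) * t) / Real.sin t : ℝ) : ℂ) * ζ ^ (-(l : ℤ) - 1))
    (f := fun x => ζ / (ζ ^ 2 * (1 - 2 * ((Real.cos t * x : ℝ) : ℂ) / ζ + (x : ℂ) ^ 2 / ζ ^ 2)))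
    (fun l _ => (R / ‖ζ‖) ^ l * (1 / (|Real.sin t| * ‖ζ‖))) ?_ ?_ ?_ ?_ ?_
  · refine aux_hasSum_congr key (fun l => ?_) rfl
    rw [integral_mul_const, integral_mul_const, integral_complex_ofReal]
  · intro l
    apply Measurable.aestronglyMeasurable
    fun_prop
  · intro l
    filter_upwards [hσ] with x hx
    have : ζ ^ (-(l : ℤ) - 1) = (ζ ^ (l+1))⁻¹ := by
      rw [← zpow_natCast, ← zpow_neg]; congr 1; push_cast; ring
    rw [this, norm_mul, norm_mul, norm_inv, norm_pow, Complex.norm_real, Complex.norm_real,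
      norm_pow, norm_div, Real.norm_eq_abs, Real.norm_eq_abs, Real.norm_eq_abs]
    have e : (R / ‖ζ‖) ^ l * (1 / (|Real.sin t| * ‖ζ‖)) =
      R ^ l * (1 / |Real.sin t|) * (‖ζ‖ ^ (l+1))⁻¹ := by
      have := abs_pos.mpr ht
      rw [div_pow, pow_succ]
      field_simp
    rw [e]
    gcongr
    exact Real.abs_sin_le_one _
  · filter_upwards with x
    apply Summable.mul_right
    exact summable_geometric_of_lt_one (by positivity) ((div_lt_one hz).mpr h)
  · exact integrable_const _
  · filter_upwards [hσ] with x hx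
    exact aux_hasSum t ht ζ x (hx.trans_lt h)

/-- Symmetrized Cauchy kernel weighted by a polynomial. -/
def auxF (T : Polynomial ℂ) (ζ : ℂ) (x : ℝ) : ℂ :=
  T.eval (Complex.I * x) / (ζ - Complex.I * x) + T.eval (-(Complex.I * x)) / (ζ + Complex.I * x)

lemma aux_poly_bound (T : Polynomial ℂ) (R : ℝ) :
    ∃ C, 0 ≤ C ∧ ∀ z : ℂ, ‖z‖ ≤ R → ‖T.eval z‖ ≤ C := by
  obtain ⟨C, hC⟩ := (isCompact_closedBall (0:ℂ) R).exists_bound_of_continuousOn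
    (f := fun z => T.eval z) T.continuous.continuousOn
  refine ⟨max C 0, le_max_right _ _, fun z hz => (hC z (by simpa using hz)).trans (le_max_left _ _)⟩

lemma aux_F_bound (T : Polynomial ℂ) (R : ℝ) : ∃ C, 0 ≤ C ∧ ∀ ζ : ℂ, R < ‖ζ‖ → ∀ x : ℝ, |x| ≤ R →
    ‖auxF T ζ x‖ ≤ C / (‖ζ‖ - R) := by
  obtain ⟨C, h0, hC⟩ := aux_poly_bound T R
  refine ⟨C + C, by positivity, fun ζ hζ x hx => ?_⟩
  have hp : 0 < ‖ζ‖ - R := by linarith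
  have hn : ‖Complex.I * (x:ℂ)‖ ≤ R := by simpa using hx
  unfold auxF
  refine (norm_add_le _ _).trans ?_
  rw [add_div, norm_div, norm_div]
  have k1 : ‖ζ‖ - R ≤ ‖ζ - Complex.I * x‖ := by
    have := norm_sub_norm_le ζ (Complex.I * x)
    linarith
  have k2 : ‖ζ‖ - R ≤ ‖ζ + Complex.I * x‖ := by
    have := norm_sub_norm_le ζ (-(Complex.I * x))
    rw [norm_neg, sub_neg_eq_add] at this
    linarith
  have l1 := hC _ hn
  have l2 := hC (-(Complex.I * x)) (by rwa [norm_neg])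
  gcongr

lemma aux_F_meas (T : Polynomial ℂ) (ζ : ℂ) : Measurable (auxF T ζ) := by
  unfold auxF
  have h1 : Measurable fun x : ℝ => T.eval (Complex.I * x) :=
    (T.continuous.comp (by fun_prop)).measurable
  have h2 : Measurable fun x : ℝ => T.eval (-(Complex.I * x)) :=
    (T.continuous.comp (by fun_prop)).measurable
  fun_prop

lemma aux_F_int (σ : Measure ℝ) [IsFiniteMeasure σ] (R : ℝ)
    (hσ : ∀ᵐ x ∂σ, |x| ≤ R) (T : Polynomial ℂ) (ζ : ℂ) (h : R < ‖ζ‖) :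
    Integrable (auxF T ζ) σ := by
  obtain ⟨C, -, hC⟩ := aux_F_bound T R
  exact aux_integrable σ R hσ _ (aux_F_meas T ζ) _ (hC ζ h)

lemma aux_F_tendsto (σ : Measure ℝ) [IsFiniteMeasure σ] (R : ℝ)
    (hσ : ∀ᵐ x ∂σ, |x| ≤ R) (T : Polynomial ℂ) :
    Filter.Tendsto (fun n : ℕ => ∫ x, auxF T (n : ℂ) x ∂σ) Filter.atTop (nhds 0) := by
  obtain ⟨C, -, hC⟩ := aux_F_bound T R
  have hlim : Filter.Tendsto (fun n : ℕ => C / ((n:ℝ) - R) * σ.real Set.univ)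
      Filter.atTop (nhds 0) := by
    have : Filter.Tendsto (fun n : ℕ => (n:ℝ) - R) Filter.atTop Filter.atTop :=
      Filter.tendsto_atTop_add_const_right _ _ tendsto_natCast_atTop_atTop
    simpa using (this.const_div_atTop C).mul_const (σ.real Set.univ)
  refine squeeze_zero_norm' ?_ hlim
  filter_upwards [tendsto_natCast_atTop_atTop.eventually (Filter.eventually_gt_atTop R)] with n hn
  have := norm_integral_le_of_norm_le_const (μ := σ) (f := auxF T (n:ℂ)) (C := C / ((n:ℝ) - R))
  apply this
  filter_upwards [hσ] with x hx
  have := hC (n:ℂ) (by simpa using hn) x hx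
  simpa using this

lemma aux_F_X (σ : Measure ℝ) [IsFiniteMeasure σ] (R : ℝ)
    (hσ : ∀ᵐ x ∂σ, |x| ≤ R) (T : Polynomial ℂ) (ζ : ℂ) (h : R < ‖ζ‖) :
    ∫ x, auxF (T * Polynomial.X) ζ x ∂σ = ζ * ∫ x, auxF T ζ x ∂σ -
      ∫ x : ℝ, (T.eval (Complex.I * x) + T.eval (-(Complex.I * x))) ∂σ := by
  rw [← integral_const_mul, ← integral_sub]
  · apply integral_congr_ae
    filter_upwards [hσ] with x hx
    have k : ∀ u : ℂ, ‖u‖ = 1 → ζ - u * x ≠ 0 := by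
      intro u hu h0
      have : ‖ζ‖ = ‖u * x‖ := by rw [sub_eq_zero.mp h0]
      rw [norm_mul, hu, one_mul] at this
      simp at this
      linarith
    have k1 := k Complex.I (by simp)
    have k2 : ζ + Complex.I * x ≠ 0 := by simpa using k (-Complex.I) (by simp)
    simp only [auxF, Polynomial.eval_mul, Polynomial.eval_X]
    field_simp
    ring
  · exact (aux_F_int σ R hσ T ζ h).const_mul _
  · obtain ⟨C, -, hC⟩ := aux_poly_bound T R
    refine aux_integrable σ R hσ _ ?_ (C + C) ?_
    · have h1 : Measurable fun x : ℝ => T.eval (Complex.I * x) :=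
        (T.continuous.comp (by fun_prop)).measurable
      have h2 : Measurable fun x : ℝ => T.eval (-(Complex.I * x)) :=
        (T.continuous.comp (by fun_prop)).measurable
      fun_prop
    · intro x hx
      exact (norm_add_le _ _).trans (add_le_add (hC _ (by simpa using hx)) (hC _ (by simpa using hx)))

lemma aux_F_poly (σ : Measure ℝ) [IsFiniteMeasure σ] (R : ℝ)
    (hσ : ∀ᵐ x ∂σ, |x| ≤ R) (T : Polynomial ℂ) :
    ∃ D : Polynomial ℂ, ∀ ζ : ℂ, R < ‖ζ‖ →
      ∫ x, auxF T ζ x ∂σ = T.eval ζ * (∫ x, auxF 1 ζ x ∂σ) - D.eval ζ := by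
  induction T using Polynomial.induction_on with
  | C a =>
    refine ⟨0, fun ζ h => ?_⟩
    rw [Polynomial.eval_C, ← integral_const_mul, Polynomial.eval_zero, sub_zero]
    congr 1
    funext x
    simp [auxF]
    ring
  | add p q hp hq =>
    obtain ⟨D, hD⟩ := hp
    obtain ⟨E, hE⟩ := hq
    refine ⟨D + E, fun ζ h => ?_⟩
    rw [Polynomial.eval_add, Polynomial.eval_add]
    have : ∫ x, auxF (p + q) ζ x ∂σ = ∫ x, auxF p ζ x ∂σ + ∫ x, auxF q ζ x ∂σ := by
      rw [← integral_add (aux_F_int σ R hσ p ζ h) (aux_F_int σ R hσ q ζ h)]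
      congr 1
      funext x
      simp [auxF]
      ring
    rw [this, hD ζ h, hE ζ h]
    ring
  | monomial n a hp =>
    obtain ⟨D, hD⟩ := hp
    refine ⟨D * Polynomial.X + Polynomial.C (∫ x : ℝ, ((Polynomial.C a * Polynomial.X ^ n).eval (Complex.I * x) + (Polynomial.C a * Polynomial.X ^ n).eval (-(Complex.I * x))) ∂σ), fun ζ h => ?_⟩
    rw [pow_succ, ← mul_assoc, aux_F_X σ R hσ _ ζ h, hD ζ h]
    simp only [Polynomial.eval_add, Polynomial.eval_mul, Polynomial.eval_X, Polynomial.eval_C]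
    ring

lemma aux_poly_zero (A : Polynomial ℂ)
    (h : Filter.Tendsto (fun n : ℕ => A.eval (n:ℂ)) Filter.atTop (nhds 0)) : A = 0 := by
  have hd : ¬ 0 < A.degree := by
    intro hd
    have := A.tendsto_norm_atTop hd (l := Filter.atTop) (z := fun n : ℕ => (n:ℂ))
      (by simpa using tendsto_natCast_atTop_atTop)
    have h2 := h.norm
    exact not_tendsto_nhds_of_tendsto_atTop this _ h2
  rw [Polynomial.eq_C_of_degree_le_zero (not_lt.mp hd)] at h ⊢
  simp only [Polynomial.eval_C] at h
  rw [tendsto_nhds_unique tendsto_const_nhds h]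
  simp

lemma aux_rational (σ : Measure ℝ) [IsFiniteMeasure σ] (R : ℝ)
    (hσ : ∀ᵐ x ∂σ, |x| ≤ R) (p q : Polynomial ℂ) (hp : p ≠ 0)
    (h : ∀ ζ : ℂ, R < ‖ζ‖ → p.eval ζ ≠ 0 → p.eval ζ * ∫ x, auxF 1 ζ x ∂σ = q.eval ζ) :
    ∀ᵐ x : ℝ ∂σ, p.eval (Complex.I * x) = 0 := by
  set pb : Polynomial ℂ := (p.map (starRingEnd ℂ)).comp (-Polynomial.X) with hpb
  have hpbe : ∀ x : ℝ, ∀ s : ℂ, (s = Complex.I ∨ s = -Complex.I) →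
      pb.eval (s * x) = (starRingEnd ℂ) (p.eval (s * x)) := by
    intro x s hs
    have e : -(s * (x:ℂ)) = (starRingEnd ℂ) (s * x) := by rcases hs with rfl | rfl <;> simp
    rw [hpb, Polynomial.eval_comp, Polynomial.eval_neg, Polynomial.eval_X, e, Polynomial.eval_map,
      Polynomial.eval₂_hom]
  set T := p * pb with hT
  obtain ⟨D, hD⟩ := aux_F_poly σ R hσ T
  have ev1 : ∀ᶠ n : ℕ in Filter.atTop, p.eval (n:ℂ) ≠ 0 := by
    have hf : {n : ℕ | p.eval (n:ℂ) = 0}.Finite := by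
      have := p.roots.toFinset.finite_toSet.preimage (f := fun n : ℕ => (n:ℂ))
        (Nat.cast_injective.injOn)
      refine this.subset ?_
      intro n hn
      simp only [Set.mem_preimage, SetLike.mem_coe, Multiset.mem_toFinset]
      exact (Polynomial.mem_roots hp).mpr hn
    have := hf.eventually_cofinite_notMem
    rw [Nat.cofinite_eq_atTop] at this
    exact this
  have ev2 : ∀ᶠ n : ℕ in Filter.atTop, R < ‖(n:ℂ)‖ := by
    filter_upwards [tendsto_natCast_atTop_atTop.eventually (Filter.eventually_gt_atTop R)] with n hn
    simpa using hn
  have ev3 : ∀ᶠ n : ℕ in Filter.atTop, ∫ x, auxF T (n:ℂ) x ∂σ = (pb * q - D).eval (n:ℂ) := by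
    filter_upwards [ev1, ev2] with n h1 h2
    rw [hD _ h2, hT, Polynomial.eval_sub, Polynomial.eval_mul, Polynomial.eval_mul, ← h _ h2 h1]
    ring
  have hz : pb * q - D = 0 :=
    aux_poly_zero _ ((aux_F_tendsto σ R hσ T).congr' ev3)
  have ev4 : ∀ᶠ n : ℕ in Filter.atTop, ∫ x, auxF (T * Polynomial.X) (n:ℂ) x ∂σ =
      - ∫ x : ℝ, (T.eval (Complex.I * x) + T.eval (-(Complex.I * x))) ∂σ := by
    filter_upwards [ev2, ev3] with n h2 h3
    rw [aux_F_X σ R hσ _ _ h2, h3, hz]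
    simp
  have hint : ∫ x : ℝ, (T.eval (Complex.I * x) + T.eval (-(Complex.I * x))) ∂σ = 0 := by
    have := tendsto_nhds_unique tendsto_const_nhds
      ((aux_F_tendsto σ R hσ (T * Polynomial.X)).congr' ev4)
    simpa using this
  have hsq : ∀ x : ℝ, T.eval (Complex.I * x) + T.eval (-(Complex.I * x)) =
      ((‖p.eval (Complex.I * x)‖ ^ 2 + ‖p.eval (-(Complex.I * x))‖ ^ 2 : ℝ) : ℂ) := by
    intro x
    have h1 := hpbe x Complex.I (Or.inl rfl)
    have h2 := hpbe x (-Complex.I) (Or.inr rfl)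
    rw [neg_mul] at h2
    rw [hT, Polynomial.eval_mul, Polynomial.eval_mul, h1, h2, Complex.mul_conj, Complex.mul_conj,
      Complex.normSq_eq_norm_sq, Complex.normSq_eq_norm_sq]
    push_cast
    ring
  simp only [hsq] at hint
  rw [integral_complex_ofReal] at hint
  have hintr : ∫ x : ℝ, (‖p.eval (Complex.I * x)‖ ^ 2 + ‖p.eval (-(Complex.I * x))‖ ^ 2) ∂σ = 0 := by
    exact_mod_cast hint
  have hcont : Continuous fun x : ℝ => (‖p.eval (Complex.I * x)‖ ^ 2 + ‖p.eval (-(Complex.I * x))‖ ^ 2) := by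
    have h1 : Continuous fun x : ℝ => p.eval (Complex.I * x) := p.continuous.comp (by fun_prop)
    have h2 : Continuous fun x : ℝ => p.eval (-(Complex.I * x)) := p.continuous.comp (by fun_prop)
    fun_prop
  rw [integral_eq_zero_iff_of_nonneg] at hintr
  · filter_upwards [hintr] with x hx
    simp only [Pi.zero_apply] at hx
    have : ‖p.eval (Complex.I * x)‖ ^ 2 = 0 := by
      nlinarith [sq_nonneg ‖p.eval (Complex.I * x)‖, sq_nonneg ‖p.eval (-(Complex.I * x))‖]
    simpa using this
  · intro x
    simp only [Pi.zero_apply]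
    positivity
  · obtain ⟨C, h0, hC⟩ := aux_poly_bound p R
    refine Integrable.of_bound hcont.measurable.aestronglyMeasurable (C ^ 2 + C ^ 2) ?_
    filter_upwards [hσ] with x hx
    rw [Real.norm_of_nonneg (by positivity)]
    have l1 := hC (Complex.I * x) (by simpa using hx)
    have l2 := hC (-(Complex.I * x)) (by simpa using hx)
    gcongr

lemma aux_half (ζ : ℂ) (x : ℝ) (h : |x| < ‖ζ‖) :
    ζ / (ζ ^ 2 * (1 - 2 * ((Real.cos (Real.pi / 2) * x : ℝ) : ℂ) / ζ + (x : ℂ) ^ 2 / ζ ^ 2)) =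
      2⁻¹ * auxF 1 ζ x ∧ ζ ^ 2 + (x:ℂ) ^ 2 ≠ 0 ∧ auxF 1 ζ x = 2 * ζ / (ζ ^ 2 + (x:ℂ) ^ 2) := by
  have hz : 0 < ‖ζ‖ := (abs_nonneg x).trans_lt h
  have hζ : ζ ≠ 0 := norm_pos_iff.mp hz
  have k : ∀ u : ℂ, ‖u‖ = 1 → ζ - u * x ≠ 0 := by
    intro u hu h0
    have : ‖ζ‖ = ‖u * x‖ := by rw [sub_eq_zero.mp h0]
    rw [norm_mul, hu, one_mul] at this
    simp at this
    linarith
  have k1 := k Complex.I (by simp)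
  have k2 : ζ + Complex.I * x ≠ 0 := by simpa using k (-Complex.I) (by simp)
  have e : ζ ^ 2 + (x:ℂ) ^ 2 = (ζ - Complex.I * x) * (ζ + Complex.I * x) := by
    linear_combination (x:ℂ)^2 * Complex.I_sq
  have e0 : ζ ^ 2 + (x:ℂ) ^ 2 ≠ 0 := by rw [e]; exact mul_ne_zero k1 k2
  have e1 : auxF 1 ζ x = 2 * ζ / (ζ ^ 2 + (x:ℂ) ^ 2) := by
    rw [e]
    simp only [auxF, Polynomial.eval_one]
    field_simp
    ring
  refine ⟨?_, e0, e1⟩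
  have e2 : ζ ^ 2 * (1 - 2 * ((Real.cos (Real.pi / 2) * x : ℝ) : ℂ) / ζ + (x : ℂ) ^ 2 / ζ ^ 2) =
    ζ ^ 2 + (x:ℂ)^2 := by
    rw [Real.cos_pi_div_two]
    field_simp
    simp
    ring
  rw [e1, e2]
  field_simp

lemma aux_finite (σ : Measure ℝ) [IsFiniteMeasure σ] (R : ℝ)
    (s : Finset ℝ) (hs : ∀ᵐ x ∂σ, x ∈ s) (hsR : ∀ x ∈ s, |x| ≤ R) :
    ∃ q p : Polynomial ℂ, p ≠ 0 ∧ ∀ ζ : ℂ, R < ‖ζ‖ → p.eval ζ ≠ 0 ∧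
      ∫ x, auxF 1 ζ x ∂σ = q.eval ζ / p.eval ζ := by
  classical
  have h1 : ∀ ζ, ∫ x, auxF 1 ζ x ∂σ = ∑ x ∈ s, ((σ.real {x} : ℝ) : ℂ) * auxF 1 ζ x := by
    intro ζ
    have : σ = σ.restrict (s : Set ℝ) := (Measure.restrict_eq_self_of_ae_mem hs).symm
    conv_lhs => rw [this]
    rw [setIntegral_finset]
    · simp
    · rw [IntegrableOn, ← this]
      refine Integrable.of_bound (aux_F_meas 1 ζ).aestronglyMeasurable (∑ x ∈ s, ‖auxF 1 ζ x‖) ?_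
      filter_upwards [hs] with x hx
      exact Finset.single_le_sum (f := fun x => ‖auxF 1 ζ x‖) (fun _ _ => norm_nonneg _) hx
  simp only [h1]
  clear h1 hs
  induction s using Finset.induction_on with
  | empty => exact ⟨0, 1, one_ne_zero, by simp⟩
  | insert a s ha ih =>
    obtain ⟨q, p, hp, h⟩ := ih (fun x hx => hsR x (Finset.mem_insert_of_mem hx))
    refine ⟨Polynomial.C (2 * ((σ.real {a} : ℝ) : ℂ)) * Polynomial.X * p +
      q * (Polynomial.X ^ 2 + Polynomial.C ((a:ℂ) ^ 2)),
      p * (Polynomial.X ^ 2 + Polynomial.C ((a:ℂ) ^ 2)),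
      mul_ne_zero hp (Polynomial.X_pow_add_C_ne_zero two_pos _), fun ζ hζ => ?_⟩
    obtain ⟨h1, h2⟩ := h ζ hζ
    obtain ⟨-, h3, h4⟩ := aux_half ζ a ((hsR a (Finset.mem_insert_self _ _)).trans_lt hζ)
    rw [Finset.sum_insert ha, h2, h4]
    simp only [Polynomial.eval_add, Polynomial.eval_mul, Polynomial.eval_X, Polynomial.eval_C,
      Polynomial.eval_pow]
    refine ⟨mul_ne_zero h1 h3, ?_⟩
    field_simp

/-- For `μ = σ ⊗ δ₀` on `ℝ²`:
`μ̂(ζ, e^{it}) = (1/ω₂) Σ_l (∫ x^l dσ) (sin((l+1)t)/sin t) ζ^{-(l+1)}`;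
`μ` has algebraic support; and `μ̂(·, e^{iπ/2})` is rational iff `σ` has finite
support. -/
theorem markov_of_product_with_dirac
    (σ : Measure ℝ) [IsFiniteMeasure σ] (R : ℝ) (hR : 0 < R)
    (hσ : σ {x : ℝ | R < |x|} = 0)
    (μ : Measure (En 2)) (hμdef : μ = (σ.prod (Measure.dirac (0 : ℝ))).map toE2)
    (θ : ℝ → En 2) (hθ : ∀ t : ℝ, θ t = toE2 (Real.cos t, Real.sin t)) :
    (∀ t : ℝ, Real.sin t ≠ 0 → ∀ ζ : ℂ, R < ‖ζ‖ →
      HasSum (fun l : ℕ =>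
        ((omegaN 2 : ℝ) : ℂ)⁻¹ * ((∫ x : ℝ, x ^ l ∂σ : ℝ) : ℂ) *
          ((Real.sin ((l + 1) * t) / Real.sin t : ℝ) : ℂ) * ζ ^ (-(l : ℤ) - 1))
        (markovM μ ζ (θ t))) ∧
    (∃ Palg : MvPolynomial (Fin 2) ℂ, Palg ≠ 0 ∧ μ {x : En 2 | evalR Palg x ≠ 0} = 0) ∧
    ((∃ q p : Polynomial ℂ, p ≠ 0 ∧ ∀ ζ : ℂ, R < ‖ζ‖ →
        markovM μ ζ (θ (Real.pi / 2)) = q.eval ζ / p.eval ζ)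
      ↔ (∃ s : Set ℝ, s.Finite ∧ σ sᶜ = 0)) := by
  have hae : ∀ᵐ x ∂σ, |x| ≤ R := by
    rw [ae_iff]
    simpa using hσ
  have hmk : ∀ t ζ, markovM μ ζ (θ t) =
      (omegaN 2 : ℂ)⁻¹ * ∫ x : ℝ, ζ / (ζ ^ 2 * (1 - 2 * ((Real.cos t * x : ℝ) : ℂ) / ζ +
      (x : ℂ) ^ 2 / ζ ^ 2)) ∂σ := fun t ζ => by
    rw [hμdef, hθ]; exact aux_markov σ ζ t
  have hω : (omegaN 2 : ℂ) ≠ 0 := by exact_mod_cast aux_omega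
  have hmk2 : ∀ ζ : ℂ, R < ‖ζ‖ → markovM μ ζ (θ (Real.pi / 2)) =
      (omegaN 2 : ℂ)⁻¹ * (2⁻¹ * ∫ x, auxF 1 ζ x ∂σ) := by
    intro ζ h
    rw [hmk, ← integral_const_mul (2⁻¹ : ℂ)]
    congr 1
    apply integral_congr_ae
    filter_upwards [hae] with x hx
    exact (aux_half ζ x (hx.trans_lt h)).1
  refine ⟨?_, ?_, ?_, ?_⟩
  · intro t ht ζ h
    rw [hmk]
    have := (aux_part1 σ R hR hae t ht ζ h).mul_left (omegaN 2 : ℂ)⁻¹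
    simpa only [mul_assoc] using this
  · refine ⟨MvPolynomial.X 1, MvPolynomial.X_ne_zero _, ?_⟩
    have hm : Measurable toE2 := by
      unfold toE2
      apply Continuous.measurable
      fun_prop
    rw [hμdef, Measure.prod_dirac, Measure.map_map hm (by fun_prop), Measure.map_apply (hm.comp (by fun_prop))]
    · simp [evalR, toE2]
    · simp only [evalR, MvPolynomial.eval_X]
      apply MeasurableSet.compl
      apply measurableSet_eq_fun <;> fun_prop
  · rintro ⟨q, p, hp, h⟩
    have := aux_rational σ R hae p (Polynomial.C (2 * (omegaN 2 : ℂ)) * q) hp (by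
      intro ζ h1 h2
      have := h ζ h1
      rw [hmk2 ζ h1] at this
      field_simp at this
      rw [Polynomial.eval_mul, Polynomial.eval_C]
      linear_combination this)
    refine ⟨{x : ℝ | p.eval (Complex.I * x) = 0}, ?_, this⟩
    have inj : Function.Injective (fun x : ℝ => Complex.I * (x:ℂ)) := by
      intro x y hxy
      simpa using hxy
    refine (p.roots.toFinset.finite_toSet.preimage inj.injOn).subset ?_
    intro x hx
    simp only [Set.mem_preimage, SetLike.mem_coe, Multiset.mem_toFinset]
    exact (Polynomial.mem_roots hp).mpr hx
  · rintro ⟨s, hs, h⟩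
    have hfin : (s ∩ {x | |x| ≤ R}).Finite := hs.subset Set.inter_subset_left
    obtain ⟨q, p, hp, hh⟩ := aux_finite σ R hfin.toFinset (by
      have : ∀ᵐ x ∂σ, x ∈ s := h
      filter_upwards [this, hae] with x h1 h2
      simpa using ⟨h1, h2⟩) (by
      intro x hx
      simp at hx
      exact hx.2)
    refine ⟨Polynomial.C ((omegaN 2 : ℂ)⁻¹ * 2⁻¹) * q, p, hp, fun ζ hζ => ?_⟩
    rw [hmk2 ζ hζ, (hh ζ hζ).2, Polynomial.eval_mul, Polynomial.eval_C]
    ring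
end
end
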